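/- arXiv:2407.14805 — 4 statements merged into one kernel-verified Lean document; each statement's English description precedes it below -/
import Mathlib

section
/- The multiplication on E is associative with two-sided identity e0, so E is a unital associative k-algebra; the decomposition E = E^0 ⊕ E^{−1} is an algebra grading (E^0·E^0 ⊆ E^0, E^0·E^{−1} ⊆ E^{−1}, E^{−1}·E^0 ⊆ E^{−1}, and E^{−1}·E^{−1} = 0); and E admits a Frobenius form β that is graded of degree −1, i.e. β(x,y) = 0 whenever x, y are homogeneous with |x| + |y| ≠ −1. Hence E is a graded Frobenius algebra. -/
/-- The basis vectors `e0, …, e5` of the 6-dimensional vector space `E = Fin 6 → k`. -/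
def eBasis (k : Type*) [Field k] (i : Fin 6) : Fin 6 → k := Pi.single i 1

/-- The unique `k`-bilinear multiplication on `E = Fin 6 → k` for which `e0` is a two-sided
identity, `e4*e1 = e5`, `e3*e2 = e5`, `e1*e4 = −e5`, `e2*e3 = −e5`, and all other products
`e_i*e_j` with `1 ≤ i, j ≤ 5` are zero. -/
def Emul {k : Type*} [Field k] (u v : Fin 6 → k) : Fin 6 → k :=
  ![u 0 * v 0,
    u 0 * v 1 + u 1 * v 0,
    u 0 * v 2 + u 2 * v 0,
    u 0 * v 3 + u 3 * v 0,
    u 0 * v 4 + u 4 * v 0,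
    u 0 * v 5 + u 5 * v 0 + u 4 * v 1 + u 3 * v 2 - u 1 * v 4 - u 2 * v 3]

theorem mem_span_degree_zero_iff {k : Type*} [Field k] (u : Fin 6 → k) :
    u ∈ Submodule.span k {eBasis k 0, eBasis k 1, eBasis k 2} ↔ u 3 = 0 ∧ u 4 = 0 ∧ u 5 = 0 := by
  rw [Submodule.mem_span_triple]
  constructor
  · rintro ⟨a, b, c, rfl⟩
    simp [eBasis]
  · rintro ⟨h3, h4, h5⟩
    refine ⟨u 0, u 1, u 2, ?_⟩
    ext i
    fin_cases i <;> simp [eBasis, h3, h4, h5]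

theorem mem_span_degree_neg_one_iff {k : Type*} [Field k] (u : Fin 6 → k) :
    u ∈ Submodule.span k {eBasis k 3, eBasis k 4, eBasis k 5} ↔ u 0 = 0 ∧ u 1 = 0 ∧ u 2 = 0 := by
  rw [Submodule.mem_span_triple]
  constructor
  · rintro ⟨a, b, c, rfl⟩
    simp [eBasis]
  · rintro ⟨h0, h1, h2⟩
    refine ⟨u 3, u 4, u 5, ?_⟩
    ext i
    fin_cases i <;> simp [eBasis, h0, h1, h2]

theorem Emul_smul_add_left {k : Type*} [Field k] (a : k) (u v w : Fin 6 → k) :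
    Emul (a • u + v) w = a • Emul u w + Emul v w := by
  ext i
  fin_cases i <;> simp [Emul] <;> ring

theorem Emul_smul_add_right {k : Type*} [Field k] (a : k) (u v w : Fin 6 → k) :
    Emul w (a • u + v) = a • Emul w u + Emul w v := by
  ext i
  fin_cases i <;> simp [Emul] <;> ring

theorem Emul_assoc {k : Type*} [Field k] (u v w : Fin 6 → k) :
    Emul (Emul u v) w = Emul u (Emul v w) := by
  ext i
  fin_cases i <;> simp [Emul] <;> ring

/-- The Frobenius form on `E`: the coefficient of `e5` in the product. -/
def frobeniusForm (k : Type*) [Field k] : (Fin 6 → k) →ₗ[k] (Fin 6 → k) →ₗ[k] k :=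
  LinearMap.mk₂ k (fun u v => Emul u v 5)
    (fun u v w => by simpa using congrFun (Emul_smul_add_left 1 u v w) 5)
    (fun a u w => by simp [Emul]; ring)
    (fun w u v => by simpa using congrFun (Emul_smul_add_right 1 u v w) 5)
    (fun a w u => by simp [Emul]; ring)

theorem frobeniusForm_apply {k : Type*} [Field k] (u v : Fin 6 → k) :
    frobeniusForm k u v = Emul u v 5 := rfl

theorem frobeniusForm_separatingLeft {k : Type*} [Field k] (x : Fin 6 → k)
    (h : ∀ y, frobeniusForm k x y = 0) : x = 0 := by
  have h' := fun j => h (eBasis k j)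
  simp only [frobeniusForm_apply, Emul, eBasis] at h'
  ext i
  fin_cases i
  · simpa using h' 5
  · simpa using h' 4
  · simpa using h' 3
  · simpa using h' 2
  · simpa using h' 1
  · simpa using h' 0

theorem frobeniusForm_separatingRight {k : Type*} [Field k] (y : Fin 6 → k)
    (h : ∀ x, frobeniusForm k x y = 0) : y = 0 := by
  have h' := fun j => h (eBasis k j)
  simp only [frobeniusForm_apply, Emul, eBasis] at h'
  ext i
  fin_cases i
  · simpa using h' 5
  · simpa using h' 4
  · simpa using h' 3
  · simpa using h' 2
  · simpa using h' 1
  · simpa using h' 0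

/-- The multiplication `Emul` on `E` is (bilinear and) associative with
two-sided identity `e0`, so `E` is a unital associative `k`-algebra; the decomposition
`E = E^0 ⊕ E^{−1}` with `E^0 = span{e0,e1,e2}` and `E^{−1} = span{e3,e4,e5}` is an algebra
grading; and `E` admits a Frobenius form `β` that is graded of degree `−1`, i.e. `β x y = 0`
whenever `x, y` are homogeneous with `|x| + |y| ≠ −1`.  Hence `E` is a graded Frobenius
algebra. -/
theorem ext_algebra_is_graded_frobenius (k : Type*) [Field k] [CharZero k] :
    -- bilinearity of the multiplication
    (∀ (a : k) (u v w : Fin 6 → k), Emul (a • u + v) w = a • Emul u w + Emul v w) ∧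
    (∀ (a : k) (u v w : Fin 6 → k), Emul w (a • u + v) = a • Emul w u + Emul w v) ∧
    -- associativity
    (∀ u v w : Fin 6 → k, Emul (Emul u v) w = Emul u (Emul v w)) ∧
    -- `e0` is a two-sided identity
    (∀ u : Fin 6 → k, Emul (eBasis k 0) u = u ∧ Emul u (eBasis k 0) = u) ∧
    -- `E = E^0 ⊕ E^{−1}` is an algebra grading
    (∀ u ∈ Submodule.span k {eBasis k 0, eBasis k 1, eBasis k 2},
      ∀ v ∈ Submodule.span k {eBasis k 0, eBasis k 1, eBasis k 2},
        Emul u v ∈ Submodule.span k {eBasis k 0, eBasis k 1, eBasis k 2}) ∧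
    (∀ u ∈ Submodule.span k {eBasis k 0, eBasis k 1, eBasis k 2},
      ∀ v ∈ Submodule.span k {eBasis k 3, eBasis k 4, eBasis k 5},
        Emul u v ∈ Submodule.span k {eBasis k 3, eBasis k 4, eBasis k 5}) ∧
    (∀ u ∈ Submodule.span k {eBasis k 3, eBasis k 4, eBasis k 5},
      ∀ v ∈ Submodule.span k {eBasis k 0, eBasis k 1, eBasis k 2},
        Emul u v ∈ Submodule.span k {eBasis k 3, eBasis k 4, eBasis k 5}) ∧
    (∀ u ∈ Submodule.span k {eBasis k 3, eBasis k 4, eBasis k 5},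
      ∀ v ∈ Submodule.span k {eBasis k 3, eBasis k 4, eBasis k 5},
        Emul u v = 0) ∧
    -- `E` admits a Frobenius form graded of degree `−1`
    (∃ β : (Fin 6 → k) →ₗ[k] (Fin 6 → k) →ₗ[k] k,
      (∀ x : Fin 6 → k, (∀ y : Fin 6 → k, β x y = 0) → x = 0) ∧
      (∀ y : Fin 6 → k, (∀ x : Fin 6 → k, β x y = 0) → y = 0) ∧
      (∀ x y z : Fin 6 → k, β (Emul x y) z = β x (Emul y z)) ∧
      (∀ x ∈ Submodule.span k {eBasis k 0, eBasis k 1, eBasis k 2},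
        ∀ y ∈ Submodule.span k {eBasis k 0, eBasis k 1, eBasis k 2}, β x y = 0) ∧
      (∀ x ∈ Submodule.span k {eBasis k 3, eBasis k 4, eBasis k 5},
        ∀ y ∈ Submodule.span k {eBasis k 3, eBasis k 4, eBasis k 5}, β x y = 0)) := by
  simp only [mem_span_degree_zero_iff, mem_span_degree_neg_one_iff]
  refine ⟨Emul_smul_add_left, Emul_smul_add_right, Emul_assoc, ?_, ?_, ?_, ?_, ?_,
    frobeniusForm k, frobeniusForm_separatingLeft, frobeniusForm_separatingRight, ?_, ?_, ?_⟩
  · intro u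
    constructor <;> ext i <;> fin_cases i <;> simp [Emul, eBasis]
  · rintro u ⟨hu3, hu4, hu5⟩ v ⟨hv3, hv4, hv5⟩
    simp [Emul, *]
  · rintro u ⟨hu3, hu4, hu5⟩ v ⟨hv0, hv1, hv2⟩
    simp [Emul, *]
  · rintro u ⟨hu0, hu1, hu2⟩ v ⟨hv3, hv4, hv5⟩
    simp [Emul, *]
  · rintro u ⟨hu0, hu1, hu2⟩ v ⟨hv0, hv1, hv2⟩
    simp [Emul, *]
  · intro x y z
    simp only [frobeniusForm_apply, Emul_assoc]
  · rintro x ⟨hx3, hx4, hx5⟩ y ⟨hy3, hy4, hy5⟩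
    simp [frobeniusForm_apply, Emul, *]
  · rintro x ⟨hx0, hx1, hx2⟩ y ⟨hy0, hy1, hy2⟩
    simp [frobeniusForm_apply, Emul, *]
end

section
/- There is no Frobenius form β on E that is both graded of degree −1 (β(x,y) = 0 whenever x, y are homogeneous with |x| + |y| ≠ −1) and symmetric (β(x,y) = β(y,x) for all x, y ∈ E). Hence E is not a symmetric Frobenius graded algebra. -/
section

variable {k : Type*} [Field k]

theorem Emul_eBasis_zero_left (x : Fin 6 → k) : Emul (eBasis k 0) x = x := by
  ext i
  fin_cases i <;> simp [Emul, eBasis]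

theorem Emul_eBasis_four_one : Emul (eBasis k 4) (eBasis k 1) = eBasis k 5 := by
  ext i
  fin_cases i <;> simp [Emul, eBasis]

theorem Emul_eBasis_one_four : Emul (eBasis k 1) (eBasis k 4) = -eBasis k 5 := by
  ext i
  fin_cases i <;> simp [Emul, eBasis]

theorem Emul_eBasis_five_left (y : Fin 6 → k) : Emul (eBasis k 5) y = y 0 • eBasis k 5 := by
  ext i
  fin_cases i <;> simp [Emul, eBasis]

end

/-- There is no Frobenius form `β` on `E` that is both graded of degree `−1`
(`β x y = 0` whenever `x, y` are homogeneous with `|x| + |y| ≠ −1`, where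
`E^0 = span{e0,e1,e2}` and `E^{−1} = span{e3,e4,e5}`) and symmetric (`β x y = β y x`).
Hence `E` is not a symmetric Frobenius graded algebra. -/
theorem ext_algebra_not_symmetric_frobenius (k : Type*) [Field k] [CharZero k] :
    ¬ ∃ β : (Fin 6 → k) →ₗ[k] (Fin 6 → k) →ₗ[k] k,
      (∀ x : Fin 6 → k, (∀ y : Fin 6 → k, β x y = 0) → x = 0) ∧
      (∀ y : Fin 6 → k, (∀ x : Fin 6 → k, β x y = 0) → y = 0) ∧
      (∀ x y z : Fin 6 → k, β (Emul x y) z = β x (Emul y z)) ∧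
      (∀ x ∈ Submodule.span k {eBasis k 0, eBasis k 1, eBasis k 2},
        ∀ y ∈ Submodule.span k {eBasis k 0, eBasis k 1, eBasis k 2}, β x y = 0) ∧
      (∀ x ∈ Submodule.span k {eBasis k 3, eBasis k 4, eBasis k 5},
        ∀ y ∈ Submodule.span k {eBasis k 3, eBasis k 4, eBasis k 5}, β x y = 0) ∧
      (∀ x y : Fin 6 → k, β x y = β y x) := by
  rintro ⟨β, hleft, -, hassoc, -, -, hsymm⟩
  have apply_eq (x y : Fin 6 → k) : β x y = β (eBasis k 0) (Emul x y) := by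
    rw [← hassoc, Emul_eBasis_zero_left]
  have h5 : β (eBasis k 0) (eBasis k 5) = 0 := by
    have h := hsymm (eBasis k 4) (eBasis k 1)
    rw [apply_eq, apply_eq (eBasis k 1), Emul_eBasis_four_one, Emul_eBasis_one_four,
      map_neg] at h
    exact self_eq_neg.mp h
  have hzero : eBasis k 5 = 0 := hleft _ fun y => by
    rw [apply_eq, Emul_eBasis_five_left, map_smul, h5, smul_zero]
  simpa [eBasis] using congrFun hzero 5
end

section
/- The sequence of left B-modules 0 → B →^{d3} B ⊕ B →^{d2} B ⊕ B →^{d1} B →^{ε} k → 0 is exact, where d3(u) = (u·x, u·y), d2(s, t) = ( s·(a·y² + c·x²) + t·(a·y·x + b·x·y) , s·(a·x·y + b·y·x) + t·(a·x² + c·y²) ), and d1(u, v) = u·x + v·y. (This is the minimal free resolution of the trivial module k over the cubic Artin–Schelter regular algebra B of type A.) -/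
noncomputable section

namespace CubicASRegular

variable (k : Type*) [Field k]

/-- The generator `x` of the free algebra `k⟨x,y⟩`. -/
def fx : FreeAlgebra k (Fin 2) := FreeAlgebra.ι k 0

/-- The generator `y` of the free algebra `k⟨x,y⟩`. -/
def fy : FreeAlgebra k (Fin 2) := FreeAlgebra.ι k 1

/-- The cubic relation `f1 = a·x·y² + b·y·x·y + a·y²·x + c·x³`. -/
def f1 (a b c : k) : FreeAlgebra k (Fin 2) :=
  a • (fx k * fy k * fy k) + b • (fy k * fx k * fy k) + a • (fy k * fy k * fx k) +
    c • (fx k * fx k * fx k)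

/-- The cubic relation `f2 = a·y·x² + b·x·y·x + a·x²·y + c·y³`. -/
def f2 (a b c : k) : FreeAlgebra k (Fin 2) :=
  a • (fy k * fx k * fx k) + b • (fx k * fy k * fx k) + a • (fx k * fx k * fy k) +
    c • (fy k * fy k * fy k)

/-- The relation whose ring quotient is `k⟨x,y⟩/(f1, f2)`. -/
def rel (a b c : k) : FreeAlgebra k (Fin 2) → FreeAlgebra k (Fin 2) → Prop :=
  fun p q => (p = f1 k a b c ∨ p = f2 k a b c) ∧ q = 0

/-- `B = k⟨x,y⟩/(f1, f2)`, the cubic Artin–Schelter regular algebra of type A. -/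
abbrev B (a b c : k) : Type _ := RingQuot (rel k a b c)

/-- The image of `x` in `B`. -/
def bx (a b c : k) : B k a b c := RingQuot.mkAlgHom k (rel k a b c) (fx k)

/-- The image of `y` in `B`. -/
def bY (a b c : k) : B k a b c := RingQuot.mkAlgHom k (rel k a b c) (fy k)

/-- The augmentation `ε : B → k` sending `x` and `y` to `0`; it makes `k` a left `B`-module. -/
def eps (a b c : k) : B k a b c →ₐ[k] k :=
  RingQuot.liftAlgHom k ⟨FreeAlgebra.lift k (fun _ : Fin 2 => (0 : k)), by
    rintro p q ⟨h | h, rfl⟩ <;> subst h <;> simp [f1, f2, fx, fy]⟩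

/-- Right multiplication by `x`, as a map of left modules. -/
def rmul {R : Type*} [Ring R] (x : R) : R →ₗ[R] R where
  toFun r := r * x
  map_add' u v := add_mul u v x
  map_smul' m u := by simp [smul_eq_mul, mul_assoc]

/-- `d3 : B → B ⊕ B`, `d3 u = (u·x, u·y)`. -/
def d3 (a b c : k) : B k a b c →ₗ[B k a b c] B k a b c × B k a b c :=
  (rmul (bx k a b c)).prod (rmul (bY k a b c))

/-- `d2 : B ⊕ B → B ⊕ B`,
`d2 (s, t) = (s·(a·y² + c·x²) + t·(a·y·x + b·x·y), s·(a·x·y + b·y·x) + t·(a·x² + c·y²))`. -/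
def d2 (a b c : k) : B k a b c × B k a b c →ₗ[B k a b c] B k a b c × B k a b c :=
  ((rmul (a • (bY k a b c * bY k a b c) + c • (bx k a b c * bx k a b c))).coprod
      (rmul (a • (bY k a b c * bx k a b c) + b • (bx k a b c * bY k a b c)))).prod
    ((rmul (a • (bx k a b c * bY k a b c) + b • (bY k a b c * bx k a b c))).coprod
      (rmul (a • (bx k a b c * bx k a b c) + c • (bY k a b c * bY k a b c))))

/-- `d1 : B ⊕ B → B`, `d1 (u, v) = u·x + v·y`. -/
def d1 (a b c : k) : B k a b c × B k a b c →ₗ[B k a b c] B k a b c :=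
  (rmul (bx k a b c)).coprod (rmul (bY k a b c))

end CubicASRegular

namespace CubicASRegular

section Pieces

variable (k : Type*) {A : Type*} [Field k] [Ring A] [Algebra k A]

/-- The span of the words of length `n - 4` in `x` and `y`, which is zero for `n < 4`. The shift
keeps the neighbourhood of degree zero free of case distinctions. -/
def shiftedPiece (x y : A) : ℕ → Submodule k A
  | 0 | 1 | 2 | 3 => ⊥
  | 4 => Submodule.span k {1}
  | n + 5 => (shiftedPiece x y (n + 4)).map (LinearMap.mulRight k x) ⊔
      (shiftedPiece x y (n + 4)).map (LinearMap.mulRight k y)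

variable {k} {x y : A}

lemma shiftedPiece_eq_bot {n : ℕ} (hn : n < 4) : shiftedPiece k x y n = ⊥ := by
  interval_cases n <;> rfl

lemma shiftedPiece_four : shiftedPiece k x y 4 = Submodule.span k {1} := rfl

lemma shiftedPiece_succ {n : ℕ} (hn : 4 ≤ n) :
    shiftedPiece k x y (n + 1) = (shiftedPiece k x y n).map (LinearMap.mulRight k x) ⊔
      (shiftedPiece k x y n).map (LinearMap.mulRight k y) := by
  obtain ⟨n, rfl⟩ := Nat.exists_eq_add_of_le' hn
  rfl

lemma mul_left_mem_shiftedPiece {n : ℕ} {u : A} (hu : u ∈ shiftedPiece k x y n) :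
    u * x ∈ shiftedPiece k x y (n + 1) := by
  rcases lt_or_ge n 4 with hn | hn
  · rw [shiftedPiece_eq_bot hn, Submodule.mem_bot] at hu
    simp [hu]
  · rw [shiftedPiece_succ hn]
    exact Submodule.mem_sup_left ⟨u, hu, rfl⟩

lemma mul_right_mem_shiftedPiece {n : ℕ} {u : A} (hu : u ∈ shiftedPiece k x y n) :
    u * y ∈ shiftedPiece k x y (n + 1) := by
  rcases lt_or_ge n 4 with hn | hn
  · rw [shiftedPiece_eq_bot hn, Submodule.mem_bot] at hu
    simp [hu]
  · rw [shiftedPiece_succ hn]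
    exact Submodule.mem_sup_right ⟨u, hu, rfl⟩

lemma exists_of_mem_shiftedPiece_succ {n : ℕ} (hn : 4 ≤ n) {w : A}
    (hw : w ∈ shiftedPiece k x y (n + 1)) :
    ∃ u ∈ shiftedPiece k x y n, ∃ v ∈ shiftedPiece k x y n, w = u * x + v * y := by
  rw [shiftedPiece_succ hn, Submodule.mem_sup] at hw
  obtain ⟨_, ⟨u, hu, rfl⟩, _, ⟨v, hv, rfl⟩, rfl⟩ := hw
  exact ⟨u, hu, v, hv, rfl⟩

instance finiteDimensional_shiftedPiece (n : ℕ) :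
    FiniteDimensional k (shiftedPiece k x y n) := by
  induction n with
  | zero => rw [shiftedPiece_eq_bot (by norm_num)]; infer_instance
  | succ n ih =>
    rcases lt_trichotomy n 3 with hn | rfl | hn
    · rw [shiftedPiece_eq_bot (by omega)]; infer_instance
    · rw [shiftedPiece_four]; infer_instance
    · rw [shiftedPiece_succ hn]; infer_instance

/-- The linear form with coordinates `α`. -/
def linForm (x y : A) (α : k × k) : A := α.1 • x + α.2 • y

/-- A linear form vanishing at the point `p`. -/
def vanForm (x y : A) (p : k × k) : A := p.2 • x - p.1 • y

lemma mul_linForm_mem {n : ℕ} {u : A} (hu : u ∈ shiftedPiece k x y n) (α : k × k) :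
    u * linForm x y α ∈ shiftedPiece k x y (n + 1) := by
  rw [linForm, mul_add, mul_smul_comm, mul_smul_comm]
  exact add_mem (Submodule.smul_mem _ _ (mul_left_mem_shiftedPiece hu))
    (Submodule.smul_mem _ _ (mul_right_mem_shiftedPiece hu))

lemma exists_dual {p : k × k} (hp : p ≠ 0) : ∃ α : k × k, α.1 * p.1 + α.2 * p.2 = 1 := by
  by_cases h : p.1 = 0
  · have h' : p.2 ≠ 0 := fun h' => hp (Prod.ext h h')
    exact ⟨(0, p.2⁻¹), by simp [h']⟩
  · exact ⟨(p.1⁻¹, 0), by simp [h]⟩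

lemma mul_linForm_eq {p α : k × k} (h : α.1 * p.1 + α.2 * p.2 = 1) (m₀ m₁ : A) :
    (p.1 • m₀ + p.2 • m₁) * linForm x y α =
      m₀ * x + m₁ * y - (α.2 • m₀ - α.1 • m₁) * vanForm x y p := by
  have hx : p.1 • linForm x y α = x - α.2 • vanForm x y p := by
    calc _ = (α.1 * p.1 + α.2 * p.2) • x - α.2 • vanForm x y p := by
          simp only [linForm, vanForm]
          module
      _ = _ := by rw [h, one_smul]
  have hy : p.2 • linForm x y α = y + α.1 • vanForm x y p := by
    calc _ = (α.1 * p.1 + α.2 * p.2) • y + α.1 • vanForm x y p := by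
          simp only [linForm, vanForm]
          module
      _ = _ := by rw [h, one_smul]
  rw [add_mul, smul_mul_assoc, smul_mul_assoc, ← mul_smul_comm, ← mul_smul_comm, hx, hy]
  simp only [mul_sub, mul_add, sub_mul, smul_mul_assoc, mul_smul_comm]
  abel

lemma exists_of_mem_shiftedPiece_succ' {n : ℕ} (hn : 4 ≤ n) {p α : k × k}
    (h : α.1 * p.1 + α.2 * p.2 = 1) {w : A} (hw : w ∈ shiftedPiece k x y (n + 1)) :
    ∃ u ∈ shiftedPiece k x y n, ∃ v ∈ shiftedPiece k x y n,
      w = u * linForm x y α + v * vanForm x y p := by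
  obtain ⟨u, hu, v, hv, rfl⟩ := exists_of_mem_shiftedPiece_succ hn hw
  refine ⟨p.1 • u + p.2 • v, add_mem (Submodule.smul_mem _ _ hu) (Submodule.smul_mem _ _ hv),
    α.2 • u - α.1 • v, sub_mem (Submodule.smul_mem _ _ hu) (Submodule.smul_mem _ _ hv), ?_⟩
  rw [mul_linForm_eq h, sub_add_cancel]

end Pieces

section Upper

variable {k A : Type*} [Field k] [Ring A] [Algebra k A] {x y : A} {a b c : k}

/-- The superpotential of `B`, contracted with two nonzero vectors, does not vanish. -/
lemma superpotential_nondegenerate (h1 : ¬(a = 0 ∧ b = 0)) (h2 : ¬(a = 0 ∧ c = 0))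
    (h3 : ¬(a ^ 2 = b ^ 2 ∧ b ^ 2 = c ^ 2)) {p q : k × k}
    (hxx : c * (q.1 * p.1) + a * (q.2 * p.2) = 0) (hyy : a * (q.1 * p.1) + c * (q.2 * p.2) = 0)
    (hxy : a * (q.1 * p.2) + b * (q.2 * p.1) = 0) (hyx : b * (q.1 * p.2) + a * (q.2 * p.1) = 0) :
    p = 0 ∨ q = 0 := by
  obtain ⟨p₀, p₁⟩ := p
  obtain ⟨q₀, q₁⟩ := q
  simp only [Prod.mk_eq_zero] at *
  have e1 : (a ^ 2 - c ^ 2) * (q₀ * p₀) = 0 := by linear_combination a * hyy - c * hxx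
  have e2 : (a ^ 2 - c ^ 2) * (q₁ * p₁) = 0 := by linear_combination a * hxx - c * hyy
  have e3 : (a ^ 2 - b ^ 2) * (q₀ * p₁) = 0 := by linear_combination a * hxy - b * hyx
  have e4 : (a ^ 2 - b ^ 2) * (q₁ * p₀) = 0 := by linear_combination a * hyx - b * hxy
  by_cases hc : a ^ 2 - c ^ 2 = 0
  · have hb : a ^ 2 - b ^ 2 ≠ 0 := fun hb => h3 ⟨by linear_combination hb,
      by linear_combination hc - hb⟩
    grind
  · grind

lemma exists_isotropic [IsAlgClosed k] [CharZero k] (s t r : k) :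
    ∃ u : k × k, u ≠ 0 ∧ s * u.1 ^ 2 + t * (u.1 * u.2) + r * u.2 ^ 2 = 0 := by
  by_cases hs : s = 0
  · exact ⟨(1, 0), by simp, by simp [hs]⟩
  · obtain ⟨d, hd⟩ := IsAlgClosed.exists_eq_mul_self (discrim s t r)
    obtain ⟨z, hz⟩ := exists_quadratic_eq_zero hs ⟨d, hd⟩
    exact ⟨(z, 1), by simp, by linear_combination hz⟩

/-- The coefficients of the quadratic form obtained by contracting the relation
`u.1 • f1 + u.2 • f2` with `p` in its last argument, in the order `xx`, `yx`, `xy`, `yy`; the first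
pair multiplies `x` on the left, the second one `y`. -/
def contraction (a b c : k) (u p : k × k) : (k × k) × (k × k) :=
  ((c * (u.1 * p.1) + a * (u.2 * p.2), b * (u.1 * p.2) + a * (u.2 * p.1)),
    (a * (u.1 * p.2) + b * (u.2 * p.1), a * (u.1 * p.1) + c * (u.2 * p.2)))

/-- A relation of the algebra, rewritten modulo a linear form vanishing at `p`. -/
lemma contraction_mul_linForm
    (hr1 : a • (x * y * y) + b • (y * x * y) + a • (y * y * x) + c • (x * x * x) = 0)
    (hr2 : a • (y * x * x) + b • (x * y * x) + a • (x * x * y) + c • (y * y * y) = 0)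
    (u : k × k) {p α : k × k} (h : α.1 * p.1 + α.2 * p.2 = 1) :
    ∃ γ δ : k × k,
      (linForm x y (contraction a b c u p).1 * x + linForm x y (contraction a b c u p).2 * y) *
        linForm x y α = (linForm x y γ * x + linForm x y δ * y) * vanForm x y p := by
  set m₀ : A := u.1 • (a • (y * y) + c • (x * x)) + u.2 • (a • (y * x) + b • (x * y)) with hm₀
  set m₁ : A := u.1 • (a • (x * y) + b • (y * x)) + u.2 • (a • (x * x) + c • (y * y)) with hm₁
  have hG : linForm x y (contraction a b c u p).1 * x +
      linForm x y (contraction a b c u p).2 * y = p.1 • m₀ + p.2 • m₁ := by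
    simp only [hm₀, hm₁, contraction, linForm, add_mul, smul_mul_assoc]
    module
  have h0 : m₀ * x + m₁ * y = 0 := by
    have : m₀ * x + m₁ * y =
        u.1 • (a • (x * y * y) + b • (y * x * y) + a • (y * y * x) + c • (x * x * x)) +
        u.2 • (a • (y * x * x) + b • (x * y * x) + a • (x * x * y) + c • (y * y * y)) := by
      simp only [hm₀, hm₁, add_mul, smul_mul_assoc]
      module
    rw [this, hr1, hr2, smul_zero, smul_zero, add_zero]
  refine ⟨(α.1 * (u.2 * a) - α.2 * (u.1 * c), α.1 * (u.1 * b) - α.2 * (u.2 * a)),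
    (α.1 * (u.1 * a) - α.2 * (u.2 * b), α.1 * (u.2 * c) - α.2 * (u.1 * a)), ?_⟩
  rw [hG, mul_linForm_eq h, h0, zero_sub, ← neg_mul]
  congr 1
  simp only [hm₀, hm₁, linForm, add_mul, smul_mul_assoc]
  module

lemma exists_next_point (h1 : ¬(a = 0 ∧ b = 0)) (h2 : ¬(a = 0 ∧ c = 0))
    (h3 : ¬(a ^ 2 = b ^ 2 ∧ b ^ 2 = c ^ 2))
    (hr1 : a • (x * y * y) + b • (y * x * y) + a • (y * y * x) + c • (x * x * x) = 0)
    (hr2 : a • (y * x * x) + b • (x * y * x) + a • (x * x * y) + c • (y * y * y) = 0)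
    {p q α β : k × k} (hα : α.1 * p.1 + α.2 * p.2 = 1) (hβ : β.1 * q.1 + β.2 * q.2 = 1) :
    ∃ z : k × k, z ≠ 0 ∧ ∃ γ δ ε : k × k,
      vanForm x y z * linForm x y β * linForm x y α =
        linForm x y ε * vanForm x y q * linForm x y α +
          (linForm x y γ * x + linForm x y δ * y) * vanForm x y p := by
  have key : ∀ u : k × k, ∃ γ δ ε : k × k,
      vanForm x y (-(q.1 * (contraction a b c u p).1.2 + q.2 * (contraction a b c u p).2.2),
          q.1 * (contraction a b c u p).1.1 + q.2 * (contraction a b c u p).2.1) *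
          linForm x y β * linForm x y α =
        linForm x y ε * vanForm x y q * linForm x y α +
          (linForm x y γ * x + linForm x y δ * y) * vanForm x y p := by
    intro u
    obtain ⟨γ, δ, h⟩ := contraction_mul_linForm hr1 hr2 u hα
    set G := contraction a b c u p
    refine ⟨γ, δ, (β.1 * G.2.1 - β.2 * G.1.1, β.1 * G.2.2 - β.2 * G.1.2), ?_⟩
    have e1 : vanForm x y (-(q.1 * G.1.2 + q.2 * G.2.2), q.1 * G.1.1 + q.2 * G.2.1) =
        q.1 • linForm x y G.1 + q.2 • linForm x y G.2 := by
      simp only [vanForm, linForm]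
      module
    have e2 : linForm x y (β.1 * G.2.1 - β.2 * G.1.1, β.1 * G.2.2 - β.2 * G.1.2) =
        -(β.2 • linForm x y G.1 - β.1 • linForm x y G.2) := by
      simp only [linForm]
      module
    rw [e1, mul_linForm_eq hβ, sub_mul, h, e2]
    noncomm_ring
  by_contra! hcon
  have hz : ∀ u : k × k,
      (-(q.1 * (contraction a b c u p).1.2 + q.2 * (contraction a b c u p).2.2),
          q.1 * (contraction a b c u p).1.1 + q.2 * (contraction a b c u p).2.1) = (0 : k × k) := by
    intro u
    by_contra hne
    obtain ⟨γ, δ, ε, h⟩ := key u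
    exact hcon _ hne γ δ ε h
  have hx := hz (1, 0)
  have hy := hz (0, 1)
  simp only [contraction, Prod.mk_eq_zero, neg_eq_zero] at hx hy
  rcases superpotential_nondegenerate (p := p) (q := q) h1 h2 h3
    (by linear_combination hx.2) (by linear_combination hy.1)
    (by linear_combination hy.2) (by linear_combination hx.1) with rfl | rfl
  · simp at hα
  · simp at hβ

lemma exists_rank_one [IsAlgClosed k] [CharZero k] (h1 : ¬(a = 0 ∧ b = 0))
    (h2 : ¬(a = 0 ∧ c = 0)) (h3 : ¬(a ^ 2 = b ^ 2 ∧ b ^ 2 = c ^ 2))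
    (hr1 : a • (x * y * y) + b • (y * x * y) + a • (y * y * x) + c • (x * x * x) = 0)
    (hr2 : a • (y * x * x) + b • (x * y * x) + a • (x * x * y) + c • (y * y * y) = 0)
    {p α : k × k} (hα : α.1 * p.1 + α.2 * p.2 = 1) :
    ∃ q z : k × k, q ≠ 0 ∧ z ≠ 0 ∧ ∃ γ δ : k × k,
      vanForm x y z * vanForm x y q * linForm x y α =
        (linForm x y γ * x + linForm x y δ * y) * vanForm x y p := by
  obtain ⟨u, hu, hdet⟩ := exists_isotropic
    (c * p.1 * (a * p.1) - a * p.2 * (b * p.2))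
    (c * p.1 * (c * p.2) + a * p.2 * (a * p.1) - a * p.2 * (a * p.1) - b * p.1 * (b * p.2))
    (a * p.2 * (c * p.2) - b * p.1 * (a * p.1))
  obtain ⟨γ, δ, h⟩ := contraction_mul_linForm hr1 hr2 u hα
  have hG0 : contraction a b c u p ≠ 0 := by
    intro h0
    simp only [contraction, Prod.mk_eq_zero] at h0
    rcases superpotential_nondegenerate h1 h2 h3 h0.1.1 h0.2.2 h0.2.1 h0.1.2 with rfl | rfl
    · simp at hα
    · exact hu rfl
  have hdet' : (contraction a b c u p).1.1 * (contraction a b c u p).2.2 =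
      (contraction a b c u p).1.2 * (contraction a b c u p).2.1 := by
    simp only [contraction]
    linear_combination hdet
  set G := contraction a b c u p
  obtain ⟨q, hq, hq1, hq2⟩ : ∃ q : k × k, q ≠ 0 ∧ q.1 * G.1.1 + q.2 * G.2.1 = 0 ∧
      q.1 * G.1.2 + q.2 * G.2.2 = 0 := by
    by_cases hne : G.1.1 = 0 ∧ G.2.1 = 0
    · refine ⟨(G.2.2, -G.1.2), fun h0 => hG0 ?_, by simp [hne], by ring⟩
      simp only [Prod.mk_eq_zero, neg_eq_zero] at h0
      exact Prod.ext (Prod.ext hne.1 h0.2) (Prod.ext hne.2 h0.1)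
    · refine ⟨(G.2.1, -G.1.1), fun h0 => hne ?_, by ring, by linear_combination -hdet'⟩
      simp only [Prod.mk_eq_zero, neg_eq_zero] at h0
      exact h0.symm
  obtain ⟨β, hβ⟩ := exists_dual hq
  have e0 : q.1 • linForm x y G.1 + q.2 • linForm x y G.2 = 0 := by
    have : q.1 • linForm x y G.1 + q.2 • linForm x y G.2 =
        (q.1 * G.1.1 + q.2 * G.2.1) • x + (q.1 * G.1.2 + q.2 * G.2.2) • y := by
      simp only [linForm]
      module
    rw [this, hq1, hq2, zero_smul, zero_smul, add_zero]
  have e1 := mul_linForm_eq (x := x) (y := y) hβ (linForm x y G.1) (linForm x y G.2)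
  rw [e0, zero_mul, eq_comm, sub_eq_zero] at e1
  have e2 : vanForm x y (β.1 * G.2.2 - β.2 * G.1.2, β.2 * G.1.1 - β.1 * G.2.1) =
      β.2 • linForm x y G.1 - β.1 • linForm x y G.2 := by
    simp only [vanForm, linForm]
    module
  refine ⟨q, _, hq, fun h0 => hG0 ?_, γ, δ, by rw [e2, ← e1, h]⟩
  simp only [Prod.mk_eq_zero] at h0
  refine Prod.ext (Prod.ext ?_ ?_) (Prod.ext ?_ ?_) <;> simp only [Prod.fst_zero, Prod.snd_zero]
  · linear_combination β.1 * hq1 + q.2 * h0.2 - G.1.1 * hβ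
  · linear_combination β.1 * hq2 - q.2 * h0.1 - G.1.2 * hβ
  · linear_combination β.2 * hq1 - q.1 * h0.2 - G.2.1 * hβ
  · linear_combination β.2 * hq2 + q.1 * h0.1 - G.2.2 * hβ

/-- The graded pieces of a point module are at most one-dimensional. -/
lemma exists_point_module_bound (h1 : ¬(a = 0 ∧ b = 0)) (h2 : ¬(a = 0 ∧ c = 0))
    (h3 : ¬(a ^ 2 = b ^ 2 ∧ b ^ 2 = c ^ 2))
    (hr1 : a • (x * y * y) + b • (y * x * y) + a • (y * y * x) + c • (x * x * x) = 0)
    (hr2 : a • (y * x * x) + b • (x * y * x) + a • (x * x * y) + c • (y * y * y) = 0)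
    (n : ℕ) {p q α : k × k} (hα : α.1 * p.1 + α.2 * p.2 = 1) (hq : q ≠ 0) :
    ∃ g : A, ∀ w ∈ shiftedPiece k x y (n + 2), ∃ t : k, ∃ u ∈ shiftedPiece k x y (n + 1),
      ∃ v ∈ shiftedPiece k x y n,
        w = t • g + u * vanForm x y p + v * vanForm x y q * linForm x y α := by
  induction n generalizing p q α with
  | zero =>
    refine ⟨0, fun w hw => ⟨0, 0, zero_mem _, 0, zero_mem _, ?_⟩⟩
    rw [shiftedPiece_eq_bot (by norm_num), Submodule.mem_bot] at hw
    simp [hw]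
  | succ n ih =>
    rcases lt_trichotomy n 1 with hn | rfl | hn
    · refine ⟨0, fun w hw => ⟨0, 0, zero_mem _, 0, zero_mem _, ?_⟩⟩
      rw [shiftedPiece_eq_bot (by omega), Submodule.mem_bot] at hw
      simp [hw]
    · refine ⟨1, fun w hw => ?_⟩
      obtain ⟨t, rfl⟩ := Submodule.mem_span_singleton.1 hw
      exact ⟨t, 0, zero_mem _, 0, zero_mem _, by simp⟩
    · obtain ⟨β, hβ⟩ := exists_dual hq
      obtain ⟨z, hz, γ, δ, ε, hrel⟩ := exists_next_point h1 h2 h3 hr1 hr2 hα hβ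
      obtain ⟨g, hg⟩ := ih hβ hz
      refine ⟨g * linForm x y α, fun w hw => ?_⟩
      obtain ⟨w₁, hw₁, w₂, hw₂, rfl⟩ := exists_of_mem_shiftedPiece_succ' (by omega) hα hw
      obtain ⟨t, u, hu, v, hv, rfl⟩ := hg w₁ hw₁
      refine ⟨t, v * (linForm x y γ * x + linForm x y δ * y) + w₂, ?_,
        u + v * linForm x y ε, add_mem hu (mul_linForm_mem hv ε), ?_⟩
      · rw [mul_add, ← mul_assoc, ← mul_assoc]
        exact add_mem (add_mem (mul_left_mem_shiftedPiece (mul_linForm_mem hv γ))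
          (mul_right_mem_shiftedPiece (mul_linForm_mem hv δ))) hw₂
      · have : v * vanForm x y z * linForm x y β * linForm x y α =
            v * (vanForm x y z * linForm x y β * linForm x y α) := by noncomm_ring
        rw [add_mul, add_mul, this, hrel, smul_mul_assoc]
        noncomm_ring

/-- The graded pieces of a line module are no larger than expected. -/
lemma exists_line_module_bound [IsAlgClosed k] [CharZero k] (h1 : ¬(a = 0 ∧ b = 0))
    (h2 : ¬(a = 0 ∧ c = 0)) (h3 : ¬(a ^ 2 = b ^ 2 ∧ b ^ 2 = c ^ 2))
    (hr1 : a • (x * y * y) + b • (y * x * y) + a • (y * y * x) + c • (x * x * x) = 0)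
    (hr2 : a • (y * x * x) + b • (x * y * x) + a • (x * x * y) + c • (y * y * y) = 0)
    (n : ℕ) {p : k × k} (hp : p ≠ 0) :
    ∃ S : Submodule k A, FiniteDimensional k S ∧ Module.finrank k S ≤ (n + 1) / 2 - 1 ∧
      ∀ w ∈ shiftedPiece k x y (n + 1), ∃ s ∈ S, ∃ u ∈ shiftedPiece k x y n,
        w = s + u * vanForm x y p := by
  induction n using Nat.twoStepInduction generalizing p with
  | zero =>
    refine ⟨⊥, inferInstance, by simp, fun w hw => ⟨0, zero_mem _, 0, zero_mem _, ?_⟩⟩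
    rw [shiftedPiece_eq_bot (by norm_num), Submodule.mem_bot] at hw
    simp [hw]
  | one =>
    refine ⟨⊥, inferInstance, by simp, fun w hw => ⟨0, zero_mem _, 0, zero_mem _, ?_⟩⟩
    rw [shiftedPiece_eq_bot (by norm_num), Submodule.mem_bot] at hw
    simp [hw]
  | more n ih _ =>
    rcases Nat.eq_zero_or_pos n with rfl | hn
    · refine ⟨⊥, inferInstance, by simp, fun w hw => ⟨0, zero_mem _, 0, zero_mem _, ?_⟩⟩
      rw [shiftedPiece_eq_bot (by norm_num), Submodule.mem_bot] at hw
      simp [hw]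
    obtain ⟨α, hα⟩ := exists_dual hp
    obtain ⟨q, z, hq, hz, γ, δ, hrel⟩ := exists_rank_one h1 h2 h3 hr1 hr2 hα
    obtain ⟨g, hg⟩ := exists_point_module_bound h1 h2 h3 hr1 hr2 (n + 1) hα hq
    obtain ⟨S, _, hS, hS'⟩ := ih hz
    refine ⟨Submodule.span k {g} ⊔
      S.map (LinearMap.mulRight k (vanForm x y q * linForm x y α)), inferInstance, ?_, ?_⟩
    · have e1 := Submodule.finrank_add_le_finrank_add_finrank (Submodule.span k {g})
        (S.map (LinearMap.mulRight k (vanForm x y q * linForm x y α)))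
      have e2 : Module.finrank k (Submodule.span k {g}) ≤ 1 := by
        simpa using finrank_span_le_card (R := k) {g}
      have e3 := Submodule.finrank_map_le
        (LinearMap.mulRight k (vanForm x y q * linForm x y α)) S
      omega
    · intro w hw
      obtain ⟨t, u, hu, v, hv, rfl⟩ := hg w hw
      obtain ⟨s, hs, v', hv', rfl⟩ := hS' v hv
      refine ⟨t • g + s * (vanForm x y q * linForm x y α), add_mem (Submodule.mem_sup_left
        (Submodule.smul_mem _ _ (Submodule.mem_span_singleton_self g)))
        (Submodule.mem_sup_right ⟨s, hs, rfl⟩),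
        u + v' * (linForm x y γ * x + linForm x y δ * y), ?_, ?_⟩
      · rw [mul_add, ← mul_assoc, ← mul_assoc]
        exact add_mem hu (add_mem (mul_left_mem_shiftedPiece (mul_linForm_mem hv' γ))
          (mul_right_mem_shiftedPiece (mul_linForm_mem hv' δ)))
      · have : v' * vanForm x y z * vanForm x y q * linForm x y α =
            v' * (vanForm x y z * vanForm x y q * linForm x y α) := by noncomm_ring
        rw [add_mul, add_mul, this, hrel]
        noncomm_ring

lemma finrank_shiftedPiece_succ_le [IsAlgClosed k] [CharZero k] (h1 : ¬(a = 0 ∧ b = 0))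
    (h2 : ¬(a = 0 ∧ c = 0)) (h3 : ¬(a ^ 2 = b ^ 2 ∧ b ^ 2 = c ^ 2))
    (hr1 : a • (x * y * y) + b • (y * x * y) + a • (y * y * x) + c • (x * x * x) = 0)
    (hr2 : a • (y * x * x) + b • (x * y * x) + a • (x * x * y) + c • (y * y * y) = 0)
    (n : ℕ) :
    Module.finrank k (shiftedPiece k x y (n + 1)) ≤
      (n + 1) / 2 - 1 +
        Module.finrank k ((shiftedPiece k x y n).map (LinearMap.mulRight k x)) := by
  obtain ⟨S, _, hS, hS'⟩ := exists_line_module_bound h1 h2 h3 hr1 hr2 n (p := (0, 1)) (by simp)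
  have hle : shiftedPiece k x y (n + 1) ≤
      S ⊔ (shiftedPiece k x y n).map (LinearMap.mulRight k x) := by
    intro w hw
    obtain ⟨s, hs, u, hu, rfl⟩ := hS' w hw
    exact add_mem (Submodule.mem_sup_left hs)
      (Submodule.mem_sup_right ⟨u, hu, by simp [vanForm]⟩)
  have e1 := Submodule.finrank_mono hle
  have e2 := Submodule.finrank_add_le_finrank_add_finrank S
    ((shiftedPiece k x y n).map (LinearMap.mulRight k x))
  omega

end Upper

section Quotient

variable {k : Type*} [Field k] {a b c : k}

lemma bx_bY_rel₁ :
    a • (bx k a b c * bY k a b c * bY k a b c) + b • (bY k a b c * bx k a b c * bY k a b c) +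
      a • (bY k a b c * bY k a b c * bx k a b c) +
      c • (bx k a b c * bx k a b c * bx k a b c) = 0 := by
  have h := RingQuot.mkAlgHom_rel k
    (show rel k a b c (f1 k a b c) 0 from ⟨Or.inl rfl, rfl⟩)
  simp only [f1, map_add, map_smul, map_mul, map_zero] at h
  exact h

lemma bx_bY_rel₂ :
    a • (bY k a b c * bx k a b c * bx k a b c) + b • (bx k a b c * bY k a b c * bx k a b c) +
      a • (bx k a b c * bx k a b c * bY k a b c) +
      c • (bY k a b c * bY k a b c * bY k a b c) = 0 := by
  have h := RingQuot.mkAlgHom_rel k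
    (show rel k a b c (f2 k a b c) 0 from ⟨Or.inr rfl, rfl⟩)
  simp only [f2, map_add, map_smul, map_mul, map_zero] at h
  exact h

/-- Algebra maps out of `B` are given by two elements satisfying the two cubic relations. -/
def liftB {R : Type*} [Ring R] [Algebra k R] (x y : R)
    (hr1 : a • (x * y * y) + b • (y * x * y) + a • (y * y * x) + c • (x * x * x) = 0)
    (hr2 : a • (y * x * x) + b • (x * y * x) + a • (x * x * y) + c • (y * y * y) = 0) :
    B k a b c →ₐ[k] R :=
  RingQuot.liftAlgHom k ⟨FreeAlgebra.lift k ![x, y], by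
    rintro p q ⟨h | h, rfl⟩ <;> subst h
    · simpa [f1, fx, fy] using hr1
    · simpa [f2, fx, fy] using hr2⟩

section Lift

variable {R : Type*} [Ring R] [Algebra k R] {x y : R}
    (hr1 : a • (x * y * y) + b • (y * x * y) + a • (y * y * x) + c • (x * x * x) = 0)
    (hr2 : a • (y * x * x) + b • (x * y * x) + a • (x * x * y) + c • (y * y * y) = 0)

lemma liftB_bx : liftB x y hr1 hr2 (bx k a b c) = x := by
  simp [liftB, bx, fx]

lemma liftB_bY : liftB x y hr1 hr2 (bY k a b c) = y := by
  simp [liftB, bY, fy]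

end Lift

lemma eps_bx : eps k a b c (bx k a b c) = 0 := by simp [eps, bx, fx]

lemma eps_bY : eps k a b c (bY k a b c) = 0 := by simp [eps, bY, fy]

lemma right_induction (W : Submodule k (B k a b c)) (h1 : 1 ∈ W)
    (hx : ∀ w ∈ W, w * bx k a b c ∈ W) (hy : ∀ w ∈ W, w * bY k a b c ∈ W) (u : B k a b c) :
    u ∈ W := by
  obtain ⟨u, rfl⟩ := RingQuot.mkAlgHom_surjective k (rel k a b c) u
  suffices h : ∀ w ∈ W, w * RingQuot.mkAlgHom k (rel k a b c) u ∈ W by simpa using h 1 h1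
  induction u using FreeAlgebra.induction with
  | grade0 r =>
    intro w hw
    rw [AlgHom.commutes, ← Algebra.commutes, ← Algebra.smul_def]
    exact W.smul_mem r hw
  | grade1 i => fin_cases i <;> assumption
  | mul u v hu hv =>
    intro w hw
    rw [map_mul, ← mul_assoc]
    exact hv _ (hu w hw)
  | add u v hu hv =>
    intro w hw
    rw [map_add, mul_add]
    exact add_mem (hu w hw) (hv w hw)

lemma d1_apply (p : B k a b c × B k a b c) :
    d1 k a b c p = p.1 * bx k a b c + p.2 * bY k a b c := rfl

lemma d2_apply (p : B k a b c × B k a b c) :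
    d2 k a b c p =
      (p.1 * (a • (bY k a b c * bY k a b c) + c • (bx k a b c * bx k a b c)) +
        p.2 * (a • (bY k a b c * bx k a b c) + b • (bx k a b c * bY k a b c)),
      p.1 * (a • (bx k a b c * bY k a b c) + b • (bY k a b c * bx k a b c)) +
        p.2 * (a • (bx k a b c * bx k a b c) + c • (bY k a b c * bY k a b c))) := rfl

lemma d3_apply (u : B k a b c) : d3 k a b c u = (u * bx k a b c, u * bY k a b c) := rfl

lemma d1_d2 (p : B k a b c × B k a b c) : d1 k a b c (d2 k a b c p) = 0 := by
  have h : d1 k a b c (d2 k a b c p) =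
      p.1 * (a • (bx k a b c * bY k a b c * bY k a b c) +
        b • (bY k a b c * bx k a b c * bY k a b c) +
        a • (bY k a b c * bY k a b c * bx k a b c) +
        c • (bx k a b c * bx k a b c * bx k a b c)) +
      p.2 * (a • (bY k a b c * bx k a b c * bx k a b c) +
        b • (bx k a b c * bY k a b c * bx k a b c) +
        a • (bx k a b c * bx k a b c * bY k a b c) +
        c • (bY k a b c * bY k a b c * bY k a b c)) := by
    simp only [d1_apply, d2_apply, mul_add, add_mul, mul_smul_comm, smul_mul_assoc, ← mul_assoc]
    abel
  rw [h, bx_bY_rel₁, bx_bY_rel₂, mul_zero, mul_zero, add_zero]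

lemma d2_d3 (u : B k a b c) : d2 k a b c (d3 k a b c u) = 0 := by
  have h : d2 k a b c (d3 k a b c u) =
      (u * (a • (bx k a b c * bY k a b c * bY k a b c) +
        b • (bY k a b c * bx k a b c * bY k a b c) +
        a • (bY k a b c * bY k a b c * bx k a b c) +
        c • (bx k a b c * bx k a b c * bx k a b c)),
      u * (a • (bY k a b c * bx k a b c * bx k a b c) +
        b • (bx k a b c * bY k a b c * bx k a b c) +
        a • (bx k a b c * bx k a b c * bY k a b c) +
        c • (bY k a b c * bY k a b c * bY k a b c))) := by
    simp only [d2_apply, d3_apply, mul_add, mul_smul_comm, ← mul_assoc]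
    congr 1 <;> abel
  rw [h, bx_bY_rel₁, bx_bY_rel₂, mul_zero, Prod.mk_zero_zero]

section Presentation

variable (k a b c)

/-- The vector space `k ⊕ coker d2`, on which `B` acts from the right. -/
abbrev Presented : Type _ :=
  k × ((B k a b c × B k a b c) ⧸ LinearMap.range (d2 k a b c))

/-- The map `k ⊕ coker d2 → B` given by the unit and `d1`. -/
def presentedToB : Presented k a b c →ₗ[k] B k a b c :=
  (Algebra.linearMap k (B k a b c)).coprod
    (((LinearMap.range (d2 k a b c)).liftQ (d1 k a b c)
      (by rintro _ ⟨p, rfl⟩; exact d1_d2 p)).restrictScalars k)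

/-- The inclusion of the two summands `B` of `B ⊕ B`, followed by the projection to
`coker d2`. -/
def toPresented (u v : B k a b c) : Presented k a b c :=
  (0, Submodule.Quotient.mk (u, v))

/-- The operator on `k ⊕ coker d2` by which `x` acts. -/
def presentedX : Module.End k (Presented k a b c) where
  toFun e := toPresented k a b c (presentedToB k a b c e) 0
  map_add' e e' := by
    rw [map_add]
    exact Prod.ext (by simp [toPresented])
      (by simp [toPresented, ← Submodule.Quotient.mk_add])
  map_smul' r e := by
    rw [map_smul]
    exact Prod.ext (by simp [toPresented])
      (by simp [toPresented, ← Submodule.Quotient.mk_smul])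

/-- The operator on `k ⊕ coker d2` by which `y` acts. -/
def presentedY : Module.End k (Presented k a b c) where
  toFun e := toPresented k a b c 0 (presentedToB k a b c e)
  map_add' e e' := by
    rw [map_add]
    exact Prod.ext (by simp [toPresented])
      (by simp [toPresented, ← Submodule.Quotient.mk_add])
  map_smul' r e := by
    rw [map_smul]
    exact Prod.ext (by simp [toPresented])
      (by simp [toPresented, ← Submodule.Quotient.mk_smul])

variable {k a b c}

lemma presentedToB_toPresented (u v : B k a b c) :
    presentedToB k a b c (toPresented k a b c u v) = u * bx k a b c + v * bY k a b c := by
  simp [presentedToB, toPresented, d1_apply]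

lemma toPresented_add (u v u' v' : B k a b c) :
    toPresented k a b c u v + toPresented k a b c u' v' =
      toPresented k a b c (u + u') (v + v') :=
  Prod.ext (add_zero 0) rfl

lemma smul_toPresented (r : k) (u v : B k a b c) :
    r • toPresented k a b c u v = toPresented k a b c (r • u) (r • v) :=
  Prod.ext (smul_zero r) rfl

lemma toPresented_eq_zero {u v : B k a b c} :
    toPresented k a b c u v = 0 ↔ (u, v) ∈ LinearMap.range (d2 k a b c) := by
  rw [toPresented, Prod.mk_eq_zero, Submodule.Quotient.mk_eq_zero]
  simp only [true_and]

lemma presentedX_apply (e : Presented k a b c) :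
    presentedX k a b c e = toPresented k a b c (presentedToB k a b c e) 0 := rfl

lemma presentedY_apply (e : Presented k a b c) :
    presentedY k a b c e = toPresented k a b c 0 (presentedToB k a b c e) := rfl

variable (k a b c)

/-- The right action of `B` on `k ⊕ coker d2`. -/
def presentedAction : B k a b c →ₐ[k] (Module.End k (Presented k a b c))ᵐᵒᵖ :=
  liftB (MulOpposite.op (presentedX k a b c)) (MulOpposite.op (presentedY k a b c))
    (by
      apply MulOpposite.unop_injective
      refine LinearMap.ext fun e => ?_
      simp only [MulOpposite.unop_add, MulOpposite.unop_smul, MulOpposite.unop_mul,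
        MulOpposite.unop_op, MulOpposite.unop_zero, LinearMap.add_apply, LinearMap.smul_apply,
        Module.End.mul_apply, presentedX_apply, presentedY_apply, presentedToB_toPresented,
        smul_toPresented, toPresented_add, LinearMap.zero_apply, toPresented_eq_zero]
      refine ⟨(presentedToB k a b c e, 0), ?_⟩
      rw [d2_apply]
      simp only [mul_add, mul_smul_comm, zero_mul, add_zero, smul_zero, zero_add, ← mul_assoc])
    (by
      apply MulOpposite.unop_injective
      refine LinearMap.ext fun e => ?_
      simp only [MulOpposite.unop_add, MulOpposite.unop_smul, MulOpposite.unop_mul,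
        MulOpposite.unop_op, MulOpposite.unop_zero, LinearMap.add_apply, LinearMap.smul_apply,
        Module.End.mul_apply, presentedX_apply, presentedY_apply, presentedToB_toPresented,
        smul_toPresented, toPresented_add, LinearMap.zero_apply, toPresented_eq_zero]
      refine ⟨(0, presentedToB k a b c e), ?_⟩
      rw [d2_apply]
      simp only [mul_add, mul_smul_comm, zero_mul, add_zero, smul_zero, zero_add, ← mul_assoc])

/-- The orbit map of `1 ∈ k`, which inverts `presentedToB`. -/
def bToPresented : B k a b c →ₗ[k] Presented k a b c where
  toFun u := (presentedAction k a b c u).unop (1, 0)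
  map_add' u v := by simp
  map_smul' r u := by simp

variable {k a b c}

lemma bToPresented_mul_bx (u : B k a b c) :
    bToPresented k a b c (u * bx k a b c) =
      toPresented k a b c (presentedToB k a b c (bToPresented k a b c u)) 0 := by
  simp only [bToPresented, LinearMap.coe_mk, AddHom.coe_mk, map_mul, MulOpposite.unop_mul,
    Module.End.mul_apply]
  rw [presentedAction, liftB_bx]
  rfl

lemma bToPresented_mul_bY (u : B k a b c) :
    bToPresented k a b c (u * bY k a b c) =
      toPresented k a b c 0 (presentedToB k a b c (bToPresented k a b c u)) := by
  simp only [bToPresented, LinearMap.coe_mk, AddHom.coe_mk, map_mul, MulOpposite.unop_mul,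
    Module.End.mul_apply]
  rw [presentedAction, liftB_bY]
  rfl

lemma presentedToB_bToPresented (u : B k a b c) :
    presentedToB k a b c (bToPresented k a b c u) = u := by
  refine right_induction (LinearMap.eqLocus (presentedToB k a b c ∘ₗ bToPresented k a b c)
    LinearMap.id) ?_ (fun w hw => ?_) (fun w hw => ?_) u
  · simp [bToPresented, presentedToB]
  · simp only [LinearMap.mem_eqLocus, LinearMap.comp_apply, LinearMap.id_apply] at hw ⊢
    rw [bToPresented_mul_bx, presentedToB_toPresented, hw, zero_mul, add_zero]
  · simp only [LinearMap.mem_eqLocus, LinearMap.comp_apply, LinearMap.id_apply] at hw ⊢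
    rw [bToPresented_mul_bY, presentedToB_toPresented, hw, zero_mul, zero_add]

lemma range_d2_eq_ker_d1 : LinearMap.range (d2 k a b c) = LinearMap.ker (d1 k a b c) := by
  apply le_antisymm
  · rintro _ ⟨p, rfl⟩
    exact d1_d2 p
  · rintro ⟨u, v⟩ h
    rw [LinearMap.mem_ker, d1_apply] at h
    have h' := congrArg (bToPresented k a b c) h
    rwa [map_add, bToPresented_mul_bx, bToPresented_mul_bY, presentedToB_bToPresented,
      presentedToB_bToPresented, toPresented_add, add_zero, zero_add, map_zero,
      toPresented_eq_zero] at h'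

lemma eps_d1 (p : B k a b c × B k a b c) : eps k a b c (d1 k a b c p) = 0 := by
  rw [d1_apply, map_add, map_mul, map_mul, eps_bx, eps_bY, mul_zero, mul_zero, add_zero]

lemma eps_eq_zero_iff (u : B k a b c) :
    eps k a b c u = 0 ↔ u ∈ LinearMap.range (d1 k a b c) := by
  constructor
  · intro h
    obtain ⟨r, p, hu⟩ : ∃ (r : k) (p : B k a b c × B k a b c),
        u = algebraMap k _ r + d1 k a b c p := by
      have hu := presentedToB_bToPresented u
      generalize bToPresented k a b c u = e at hu
      obtain ⟨r, m⟩ := e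
      obtain ⟨p, rfl⟩ := Submodule.Quotient.mk_surjective _ m
      exact ⟨r, p, by rw [← hu]; simp [presentedToB]⟩
    rw [hu, map_add, eps_d1, add_zero, AlgHom.commutes, Algebra.algebraMap_self_apply] at h
    exact ⟨p, by rw [hu, h, map_zero, zero_add]⟩
  · rintro ⟨p, rfl⟩
    exact eps_d1 p

end Presentation

section Projection

open Polynomial

/-- The grading of `B`, as the algebra map sending `x` and `y` to `x·T` and `y·T`. -/
def coaction (k : Type*) [Field k] (a b c : k) : B k a b c →ₐ[k] (B k a b c)[X] :=
  liftB (monomial 1 (bx k a b c)) (monomial 1 (bY k a b c))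
    (by simp only [monomial_mul_monomial, smul_monomial, ← map_add, bx_bY_rel₁, map_zero])
    (by simp only [monomial_mul_monomial, smul_monomial, ← map_add, bx_bY_rel₂, map_zero])

/-- The projection of `B` to its component of degree `n - 4`. -/
def pieceProj (k : Type*) [Field k] (a b c : k) (n : ℕ) : B k a b c →ₗ[k] B k a b c where
  toFun u := (coaction k a b c u * X ^ 4).coeff n
  map_add' u v := by rw [map_add, add_mul, coeff_add]
  map_smul' r u := by rw [map_smul, smul_mul_assoc, coeff_smul, RingHom.id_apply]

lemma pieceProj_zero (u : B k a b c) : pieceProj k a b c 0 u = 0 := by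
  simp [pieceProj]

lemma pieceProj_one (n : ℕ) : pieceProj k a b c n 1 = if n = 4 then 1 else 0 := by
  simp [pieceProj, coeff_X_pow]

lemma pieceProj_mul_bx (n : ℕ) (u : B k a b c) :
    pieceProj k a b c (n + 1) (u * bx k a b c) = pieceProj k a b c n u * bx k a b c := by
  have h : coaction k a b c (bx k a b c) = C (bx k a b c) * X := by
    rw [coaction, liftB_bx, C_mul_X_eq_monomial]
  simp only [pieceProj, LinearMap.coe_mk, AddHom.coe_mk]
  rw [map_mul, h, mul_assoc, mul_assoc, ← pow_succ', pow_succ, ← mul_assoc (C _), ← X_pow_mul_C,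
    mul_assoc, ← mul_assoc, ← mul_assoc, coeff_mul_X, coeff_mul_C]

lemma pieceProj_mul_bY (n : ℕ) (u : B k a b c) :
    pieceProj k a b c (n + 1) (u * bY k a b c) = pieceProj k a b c n u * bY k a b c := by
  have h : coaction k a b c (bY k a b c) = C (bY k a b c) * X := by
    rw [coaction, liftB_bY, C_mul_X_eq_monomial]
  simp only [pieceProj, LinearMap.coe_mk, AddHom.coe_mk]
  rw [map_mul, h, mul_assoc, mul_assoc, ← pow_succ', pow_succ, ← mul_assoc (C _), ← X_pow_mul_C,
    mul_assoc, ← mul_assoc, ← mul_assoc, coeff_mul_X, coeff_mul_C]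

lemma d2_pieceProj (n : ℕ) (p : B k a b c × B k a b c) :
    d2 k a b c (pieceProj k a b c n p.1, pieceProj k a b c n p.2) =
      (pieceProj k a b c (n + 2) (d2 k a b c p).1, pieceProj k a b c (n + 2) (d2 k a b c p).2) := by
  simp only [d2_apply, mul_add, mul_smul_comm, ← mul_assoc, map_add, map_smul, pieceProj_mul_bx,
    pieceProj_mul_bY]

lemma pieceProj_mem (n : ℕ) (u : B k a b c) :
    pieceProj k a b c n u ∈ shiftedPiece k (bx k a b c) (bY k a b c) n := by
  have h := right_induction (⨅ n, (shiftedPiece k (bx k a b c) (bY k a b c) n).comap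
    (pieceProj k a b c n)) ?_ (fun w hw => ?_) (fun w hw => ?_) u
  · simp only [Submodule.mem_iInf, Submodule.mem_comap] at h
    exact h n
  · simp only [Submodule.mem_iInf, Submodule.mem_comap]
    intro n
    rw [pieceProj_one]
    split_ifs with hn
    · rw [hn, shiftedPiece_four]
      exact Submodule.mem_span_singleton_self 1
    · exact zero_mem _
  · simp only [Submodule.mem_iInf, Submodule.mem_comap] at hw ⊢
    rintro (_ | n)
    · rw [pieceProj_zero]
      exact zero_mem _
    · rw [pieceProj_mul_bx]
      exact mul_left_mem_shiftedPiece (hw n)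
  · simp only [Submodule.mem_iInf, Submodule.mem_comap] at hw ⊢
    rintro (_ | n)
    · rw [pieceProj_zero]
      exact zero_mem _
    · rw [pieceProj_mul_bY]
      exact mul_right_mem_shiftedPiece (hw n)

lemma pieceProj_of_mem {n : ℕ} {u : B k a b c}
    (hu : u ∈ shiftedPiece k (bx k a b c) (bY k a b c) n) : pieceProj k a b c n u = u := by
  induction n generalizing u with
  | zero =>
    rw [shiftedPiece_eq_bot (by norm_num), Submodule.mem_bot] at hu
    rw [hu, map_zero]
  | succ n ih =>
    rcases lt_trichotomy n 3 with hn | rfl | hn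
    · rw [shiftedPiece_eq_bot (by omega), Submodule.mem_bot] at hu
      rw [hu, map_zero]
    · obtain ⟨t, rfl⟩ := Submodule.mem_span_singleton.1 hu
      rw [map_smul, pieceProj_one, if_pos rfl]
    · obtain ⟨v, hv, w, hw, rfl⟩ := exists_of_mem_shiftedPiece_succ hn hu
      rw [map_add, pieceProj_mul_bx, pieceProj_mul_bY, ih hv, ih hw]

lemma exists_sum_pieceProj (u : B k a b c) :
    ∃ N, ∀ M ≥ N, ∑ i ∈ Finset.range M, pieceProj k a b c i u = u := by
  let W : Submodule k (B k a b c) :=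
    { carrier := {u | ∃ N, ∀ M ≥ N, ∑ i ∈ Finset.range M, pieceProj k a b c i u = u}
      zero_mem' := ⟨0, fun M _ => by simp⟩
      add_mem' := by
        rintro u v ⟨N, hN⟩ ⟨N', hN'⟩
        refine ⟨max N N', fun M hM => ?_⟩
        simp only [map_add, Finset.sum_add_distrib]
        rw [hN M (le_of_max_le_left hM), hN' M (le_of_max_le_right hM)]
      smul_mem' := by
        rintro r u ⟨N, hN⟩
        refine ⟨N, fun M hM => ?_⟩
        simp only [map_smul, ← Finset.smul_sum]
        rw [hN M hM] }
  refine right_induction W ?_ ?_ ?_ u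
  · refine ⟨5, fun M hM => ?_⟩
    simp only [pieceProj_one]
    rw [Finset.sum_ite_eq', if_pos (Finset.mem_range.2 (by omega))]
  · rintro w ⟨N, hN⟩
    refine ⟨N + 1, fun M hM => ?_⟩
    obtain ⟨M, rfl⟩ := Nat.exists_eq_add_of_le' (show 1 ≤ M by omega)
    simp only [Finset.sum_range_succ', pieceProj_mul_bx, pieceProj_zero, add_zero,
      ← Finset.sum_mul]
    rw [hN M (by omega)]
  · rintro w ⟨N, hN⟩
    refine ⟨N + 1, fun M hM => ?_⟩
    obtain ⟨M, rfl⟩ := Nat.exists_eq_add_of_le' (show 1 ≤ M by omega)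
    simp only [Finset.sum_range_succ', pieceProj_mul_bY, pieceProj_zero, add_zero,
      ← Finset.sum_mul]
    rw [hN M (by omega)]

end Projection

end Quotient

section Dimension

open Module

lemma finrank_map_add_finrank_inf_ker {K V W : Type*} [Field K] [AddCommGroup V] [Module K V]
    [AddCommGroup W] [Module K W] (f : V →ₗ[K] W) (p : Submodule K V) [FiniteDimensional K p] :
    finrank K (p.map f) + finrank K (p ⊓ LinearMap.ker f : Submodule K V) = finrank K p := by
  rw [← (f.domRestrict p).finrank_range_add_finrank_ker, LinearMap.range_domRestrict,
    LinearMap.ker_domRestrict, ← Submodule.map_comap_subtype, Submodule.finrank_map_subtype_eq]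

lemma prod_eq_range_prodMap_subtype {K V W : Type*} [Field K] [AddCommGroup V] [Module K V]
    [AddCommGroup W] [Module K W] (p : Submodule K V) (q : Submodule K W) :
    p.prod q = LinearMap.range (p.subtype.prodMap q.subtype) := by
  rw [LinearMap.range_prodMap, Submodule.range_subtype, Submodule.range_subtype]

instance finiteDimensional_prod {K V W : Type*} [Field K] [AddCommGroup V] [Module K V]
    [AddCommGroup W] [Module K W] (p : Submodule K V) (q : Submodule K W)
    [FiniteDimensional K p] [FiniteDimensional K q] : FiniteDimensional K (p.prod q) := by
  rw [prod_eq_range_prodMap_subtype]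
  infer_instance

lemma finrank_submodule_prod {K V W : Type*} [Field K] [AddCommGroup V] [Module K V]
    [AddCommGroup W] [Module K W] (p : Submodule K V) (q : Submodule K W)
    [FiniteDimensional K p] [FiniteDimensional K q] :
    finrank K (p.prod q) = finrank K p + finrank K q := by
  rw [prod_eq_range_prodMap_subtype, LinearMap.finrank_range_of_inj, finrank_prod]
  exact Prod.map_injective.2 ⟨p.injective_subtype, q.injective_subtype⟩

/-- The coefficients of `t⁴ / ((1 - t)² (1 - t²))`, the shifted Hilbert series of `B`. -/
def shiftedHilbert : ℕ → ℕ
  | 0 => 0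
  | n + 1 => shiftedHilbert n + ((n + 1) / 2 - 1)

lemma shiftedHilbert_recurrence {n : ℕ} (hn : 1 ≤ n) :
    shiftedHilbert (n + 4) + 2 * shiftedHilbert (n + 1) =
      2 * shiftedHilbert (n + 3) + shiftedHilbert n := by
  simp only [shiftedHilbert]
  omega

variable {k : Type*} [Field k] (a b c : k)

/-- The component of `B` of degree `n - 4`. -/
abbrev piece (n : ℕ) : Submodule k (B k a b c) := shiftedPiece k (bx k a b c) (bY k a b c) n

/-- The elements of degree `n - 4` in the kernel of `d2`. -/
abbrev cycles (n : ℕ) : Submodule k (B k a b c × B k a b c) :=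
  (piece a b c n).prod (piece a b c n) ⊓ LinearMap.ker ((d2 k a b c).restrictScalars k)

variable {a b c}

lemma map_d1_prod_piece {n : ℕ} (hn : 4 ≤ n) :
    ((piece a b c n).prod (piece a b c n)).map ((d1 k a b c).restrictScalars k) =
      piece a b c (n + 1) := by
  apply le_antisymm
  · rintro _ ⟨p, hp, rfl⟩
    exact add_mem (mul_left_mem_shiftedPiece hp.1) (mul_right_mem_shiftedPiece hp.2)
  · intro w hw
    obtain ⟨u, hu, v, hv, rfl⟩ := exists_of_mem_shiftedPiece_succ hn hw
    exact ⟨(u, v), ⟨hu, hv⟩, rfl⟩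

lemma prod_piece_inf_ker_d1 (n : ℕ) :
    (piece a b c (n + 2)).prod (piece a b c (n + 2)) ⊓
        LinearMap.ker ((d1 k a b c).restrictScalars k) =
      ((piece a b c n).prod (piece a b c n)).map ((d2 k a b c).restrictScalars k) := by
  apply le_antisymm
  · rintro p ⟨hp, h⟩
    obtain ⟨q, rfl⟩ : p ∈ LinearMap.range (d2 k a b c) := by
      rw [range_d2_eq_ker_d1]
      exact h
    refine ⟨(pieceProj k a b c n q.1, pieceProj k a b c n q.2),
      ⟨pieceProj_mem n q.1, pieceProj_mem n q.2⟩, ?_⟩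
    rw [LinearMap.restrictScalars_apply, d2_pieceProj, pieceProj_of_mem hp.1,
      pieceProj_of_mem hp.2]
  · rintro _ ⟨p, hp, rfl⟩
    refine ⟨?_, d1_d2 p⟩
    have h := d2_pieceProj n p
    rw [pieceProj_of_mem hp.1, pieceProj_of_mem hp.2] at h
    rw [LinearMap.restrictScalars_apply, h]
    exact ⟨pieceProj_mem _ _, pieceProj_mem _ _⟩

lemma finrank_piece_euler {n : ℕ} (hn : 1 ≤ n) :
    finrank k (piece a b c (n + 4)) + 2 * finrank k (piece a b c (n + 1)) =
      2 * finrank k (piece a b c (n + 3)) + finrank k (cycles a b c (n + 1)) := by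
  have e1 := finrank_map_add_finrank_inf_ker ((d1 k a b c).restrictScalars k)
    ((piece a b c (n + 3)).prod (piece a b c (n + 3)))
  have e2 := finrank_map_add_finrank_inf_ker ((d2 k a b c).restrictScalars k)
    ((piece a b c (n + 1)).prod (piece a b c (n + 1)))
  rw [map_d1_prod_piece (by omega), prod_piece_inf_ker_d1 (n + 1), finrank_submodule_prod] at e1
  rw [finrank_submodule_prod] at e2
  change finrank k (piece a b c (n + 4)) + _ = _ at e1
  change _ + finrank k (cycles a b c (n + 1)) = _ at e2
  omega

lemma map_d3_piece_le_cycles (n : ℕ) :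
    (piece a b c n).map ((d3 k a b c).restrictScalars k) ≤ cycles a b c (n + 1) := by
  rintro _ ⟨u, hu, rfl⟩
  exact ⟨⟨mul_left_mem_shiftedPiece hu, mul_right_mem_shiftedPiece hu⟩, d2_d3 u⟩

lemma finrank_piece_four : finrank k (piece a b c 4) = 1 := by
  refine finrank_span_singleton fun h => ?_
  simpa using congrArg (eps k a b c) h

lemma finrank_map_d3_piece {n : ℕ}
    (h : piece a b c n ⊓ LinearMap.ker ((d3 k a b c).restrictScalars k) = ⊥) :
    finrank k ((piece a b c n).map ((d3 k a b c).restrictScalars k)) =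
      finrank k (piece a b c n) := by
  have e := finrank_map_add_finrank_inf_ker ((d3 k a b c).restrictScalars k) (piece a b c n)
  rwa [h, finrank_bot, add_zero] at e

variable [IsAlgClosed k] [CharZero k]

lemma finrank_piece_succ_le (h1 : ¬(a = 0 ∧ b = 0)) (h2 : ¬(a = 0 ∧ c = 0))
    (h3 : ¬(a ^ 2 = b ^ 2 ∧ b ^ 2 = c ^ 2)) (n : ℕ) :
    finrank k (piece a b c (n + 1)) ≤
      (n + 1) / 2 - 1 + finrank k ((piece a b c n).map (LinearMap.mulRight k (bx k a b c))) :=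
  finrank_shiftedPiece_succ_le h1 h2 h3 bx_bY_rel₁ bx_bY_rel₂ n

lemma piece_inf_ker_d3_of_finrank (h1 : ¬(a = 0 ∧ b = 0)) (h2 : ¬(a = 0 ∧ c = 0))
    (h3 : ¬(a ^ 2 = b ^ 2 ∧ b ^ 2 = c ^ 2)) {n : ℕ}
    (hn : finrank k (piece a b c n) = shiftedHilbert n)
    (hn' : finrank k (piece a b c (n + 1)) = shiftedHilbert (n + 1)) :
    piece a b c n ⊓ LinearMap.ker ((d3 k a b c).restrictScalars k) = ⊥ := by
  have e1 := finrank_piece_succ_le h1 h2 h3 n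
  have e2 := finrank_map_add_finrank_inf_ker (LinearMap.mulRight k (bx k a b c)) (piece a b c n)
  rw [hn', shiftedHilbert] at e1
  have e3 : finrank k (piece a b c n ⊓ LinearMap.ker (LinearMap.mulRight k (bx k a b c)) :
      Submodule k (B k a b c)) = 0 := by omega
  rw [eq_bot_iff, ← Submodule.finrank_eq_zero.1 e3]
  exact inf_le_inf_left _ fun u hu => congrArg Prod.fst hu

lemma finrank_piece (h1 : ¬(a = 0 ∧ b = 0)) (h2 : ¬(a = 0 ∧ c = 0))
    (h3 : ¬(a ^ 2 = b ^ 2 ∧ b ^ 2 = c ^ 2)) (n : ℕ) :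
    finrank k (piece a b c n) = shiftedHilbert n := by
  induction n using Nat.strong_induction_on with
  | _ n ih =>
  rcases lt_trichotomy n 4 with hn | rfl | hn
  · rw [piece, shiftedPiece_eq_bot hn, finrank_bot]
    interval_cases n <;> rfl
  · exact finrank_piece_four
  · obtain ⟨m, rfl⟩ := Nat.exists_eq_add_of_le' hn.le
    apply le_antisymm
    · have e1 := finrank_piece_succ_le h1 h2 h3 (m + 3)
      have e2 := Submodule.finrank_map_le (LinearMap.mulRight k (bx k a b c))
        (piece a b c (m + 3))
      rw [ih (m + 3) (by omega)] at e2
      change finrank k (piece a b c (m + 4)) ≤ _ at e1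
      rw [shiftedHilbert]
      omega
    · have e1 := finrank_piece_euler (a := a) (b := b) (c := c) (n := m) (by omega)
      have e2 := shiftedHilbert_recurrence (n := m) (by omega)
      have e3 := finrank_map_d3_piece (piece_inf_ker_d3_of_finrank h1 h2 h3
        (ih m (by omega)) (ih (m + 1) (by omega)))
      have e4 := Submodule.finrank_mono (map_d3_piece_le_cycles (a := a) (b := b) (c := c) m)
      rw [e3, ih m (by omega)] at e4
      rw [ih (m + 1) (by omega), ih (m + 3) (by omega)] at e1
      omega

lemma piece_inf_ker_d3 (h1 : ¬(a = 0 ∧ b = 0)) (h2 : ¬(a = 0 ∧ c = 0))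
    (h3 : ¬(a ^ 2 = b ^ 2 ∧ b ^ 2 = c ^ 2)) (n : ℕ) :
    piece a b c n ⊓ LinearMap.ker ((d3 k a b c).restrictScalars k) = ⊥ :=
  piece_inf_ker_d3_of_finrank h1 h2 h3 (finrank_piece h1 h2 h3 n) (finrank_piece h1 h2 h3 _)

lemma cycles_eq_map_d3_piece (h1 : ¬(a = 0 ∧ b = 0)) (h2 : ¬(a = 0 ∧ c = 0))
    (h3 : ¬(a ^ 2 = b ^ 2 ∧ b ^ 2 = c ^ 2)) {n : ℕ} (hn : 1 ≤ n) :
    cycles a b c (n + 1) = (piece a b c n).map ((d3 k a b c).restrictScalars k) := by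
  symm
  refine Submodule.eq_of_le_of_finrank_eq (map_d3_piece_le_cycles n) ?_
  have e1 := finrank_piece_euler (a := a) (b := b) (c := c) hn
  have e2 := shiftedHilbert_recurrence hn
  simp only [finrank_piece h1 h2 h3] at e1
  rw [finrank_map_d3_piece (piece_inf_ker_d3 h1 h2 h3 n), finrank_piece h1 h2 h3]
  omega

lemma d3_injective (h1 : ¬(a = 0 ∧ b = 0)) (h2 : ¬(a = 0 ∧ c = 0))
    (h3 : ¬(a ^ 2 = b ^ 2 ∧ b ^ 2 = c ^ 2)) : Function.Injective (d3 k a b c) := by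
  rw [injective_iff_map_eq_zero]
  intro u hu
  rw [d3_apply, Prod.mk_eq_zero] at hu
  obtain ⟨N, hN⟩ := exists_sum_pieceProj u
  rw [← hN N le_rfl]
  refine Finset.sum_eq_zero fun n _ => ?_
  rw [← Submodule.mem_bot k, ← piece_inf_ker_d3 h1 h2 h3 n]
  refine ⟨pieceProj_mem n u, ?_⟩
  change d3 k a b c (pieceProj k a b c n u) = 0
  rw [d3_apply, ← pieceProj_mul_bx, ← pieceProj_mul_bY, hu.1, hu.2, map_zero,
    Prod.mk_zero_zero]

lemma range_d3_eq_ker_d2 (h1 : ¬(a = 0 ∧ b = 0)) (h2 : ¬(a = 0 ∧ c = 0))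
    (h3 : ¬(a ^ 2 = b ^ 2 ∧ b ^ 2 = c ^ 2)) :
    LinearMap.range (d3 k a b c) = LinearMap.ker (d2 k a b c) := by
  apply le_antisymm
  · rintro _ ⟨u, rfl⟩
    exact d2_d3 u
  · rintro p hp
    rw [LinearMap.mem_ker] at hp
    obtain ⟨N₁, hN₁⟩ := exists_sum_pieceProj p.1
    obtain ⟨N₂, hN₂⟩ := exists_sum_pieceProj p.2
    have hsum : ∑ i ∈ Finset.range (max N₁ N₂),
        (pieceProj k a b c i p.1, pieceProj k a b c i p.2) = p :=
      Prod.ext (by rw [Prod.fst_sum, hN₁ _ (le_max_left _ _)])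
        (by rw [Prod.snd_sum, hN₂ _ (le_max_right _ _)])
    rw [← hsum]
    refine sum_mem fun n _ => ?_
    have hmem : (pieceProj k a b c n p.1, pieceProj k a b c n p.2) ∈ cycles a b c n :=
      ⟨⟨pieceProj_mem n p.1, pieceProj_mem n p.2⟩, by
        change d2 k a b c (pieceProj k a b c n p.1, pieceProj k a b c n p.2) = 0
        rw [d2_pieceProj, hp, Prod.fst_zero, Prod.snd_zero, map_zero, Prod.mk_zero_zero]⟩
    rcases lt_or_ge n 4 with hn | hn
    · have h₁ : pieceProj k a b c n p.1 ∈ piece a b c n := pieceProj_mem n p.1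
      have h₂ : pieceProj k a b c n p.2 ∈ piece a b c n := pieceProj_mem n p.2
      rw [piece, shiftedPiece_eq_bot hn] at h₁ h₂
      rw [(Submodule.mem_bot k).1 h₁, (Submodule.mem_bot k).1 h₂, Prod.mk_zero_zero]
      exact zero_mem _
    · obtain ⟨n, rfl⟩ := Nat.exists_eq_add_of_le' (show 1 ≤ n by omega)
      rw [cycles_eq_map_d3_piece h1 h2 h3 (by omega)] at hmem
      obtain ⟨u, -, hu⟩ := hmem
      exact ⟨u, hu⟩

end Dimension

end CubicASRegular

open CubicASRegular in
/-- For `(a:b:c) ∈ ℙ² − 𝔇`, the sequence of left `B`-modules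
`0 → B →^{d3} B ⊕ B →^{d2} B ⊕ B →^{d1} B →^{ε} k → 0` is exact; it is the minimal free
resolution of the trivial module `k` over the cubic Artin–Schelter regular algebra
`B = k⟨x,y⟩/(f1,f2)` of type A. -/
theorem cubic_AS_regular_minimal_free_resolution_exact
    (k : Type*) [Field k] [IsAlgClosed k] [CharZero k] (a b c : k)
    (h0 : ¬(a = 0 ∧ b = 0 ∧ c = 0))
    (h1 : ¬(a = 0 ∧ b = 0))
    (h2 : ¬(a = 0 ∧ c = 0))
    (h3 : ¬(a ^ 2 = b ^ 2 ∧ b ^ 2 = c ^ 2)) :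
    Function.Injective (d3 k a b c) ∧
    LinearMap.range (d3 k a b c) = LinearMap.ker (d2 k a b c) ∧
    LinearMap.range (d2 k a b c) = LinearMap.ker (d1 k a b c) ∧
    (∀ u : B k a b c, eps k a b c u = 0 ↔ u ∈ LinearMap.range (d1 k a b c)) ∧
    Function.Surjective (eps k a b c) :=
  ⟨d3_injective h1 h2 h3, range_d3_eq_ker_d2 h1 h2 h3, range_d2_eq_ker_d1, eps_eq_zero_iff,
    fun r => ⟨algebraMap k _ r, AlgHom.commutes _ r⟩⟩
end
end

section
/- Suppose d is a differential on A with d(x1) = x1*x1, d(x2) = x2*x1, and d(x3) = x1*x3. Then: (i) for every n ≥ 1, ker d ∩ A_{2n−1} ⊆ range d; (ii) for every n ≥ 0, ker d ∩ A_{2n} = (range d ∩ A_{2n}) + k·(x2*x3)^n; and (iii) for every n ≥ 1, (x2*x3)^n ∉ range d. (Equivalently, the cohomology algebra H(A, d) is the polynomial algebra k[⌈x2x3⌉] on the degree-2 cohomology class of x2*x3.) -/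
noncomputable section

/-- `V`, the `k`-linear span of the generators `x1, x2, x3` in the free algebra
`A = k⟨x1,x2,x3⟩`; the `m`-th graded piece of `A` is `A_m = V^m`. -/
def Vgen (k : Type*) [Field k] : Submodule k (FreeAlgebra k (Fin 3)) :=
  Submodule.span k {FreeAlgebra.ι k 0, FreeAlgebra.ι k 1, FreeAlgebra.ι k 2}

/-- A differential on `A = k⟨x1,x2,x3⟩` (making `A` a connected cochain DG algebra with
generators in degree `1`): a `k`-linear map `d : A → A` with `d(A_m) ⊆ A_{m+1}`, the graded
Leibniz rule, and `d ∘ d = 0`. -/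
def IsDGDifferential (k : Type*) [Field k]
    (d : FreeAlgebra k (Fin 3) →ₗ[k] FreeAlgebra k (Fin 3)) : Prop :=
  (∀ m : ℕ, ∀ a ∈ (Vgen k) ^ m, d a ∈ (Vgen k) ^ (m + 1)) ∧
  (∀ m : ℕ, ∀ a ∈ (Vgen k) ^ m, ∀ b : FreeAlgebra k (Fin 3),
    d (a * b) = d a * b + ((-1 : k) ^ m) • (a * d b)) ∧
  (∀ a : FreeAlgebra k (Fin 3), d (d a) = 0)

namespace FreeAlgebra

variable {k : Type*} [Field k]

local notation "𝒜" => FreeAlgebra k (Fin 3)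
local notation "x₁" => FreeAlgebra.ι k (0 : Fin 3)
local notation "x₂" => FreeAlgebra.ι k (1 : Fin 3)
local notation "x₃" => FreeAlgebra.ι k (2 : Fin 3)

/-- The representation of the free algebra on `A × A³` in which `xᵢ` sends `(w, v)` to
`(xᵢ * w, w eᵢ)`. -/
def leftDerivRep (k : Type*) [Field k] :
    FreeAlgebra k (Fin 3) →ₐ[k]
      Module.End k (FreeAlgebra k (Fin 3) × (Fin 3 → FreeAlgebra k (Fin 3))) :=
  lift k fun i =>
    ((LinearMap.mulLeft k (ι k i)).prod
      (LinearMap.single k (fun _ : Fin 3 => FreeAlgebra k (Fin 3)) i)) ∘ₗ LinearMap.fst k _ _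

lemma leftDerivRep_ι (i : Fin 3) (p : 𝒜 × (Fin 3 → 𝒜)) :
    leftDerivRep k (ι k i) p = (ι k i * p.1, Pi.single i p.1) := by
  simp [leftDerivRep]

lemma leftDerivRep_fst (w : 𝒜) (p : 𝒜 × (Fin 3 → 𝒜)) :
    (leftDerivRep k w p).1 = w * p.1 := by
  induction w using FreeAlgebra.induction generalizing p with
  | grade0 r => simp [Algebra.algebraMap_eq_smul_one]
  | grade1 i => simp [leftDerivRep_ι]
  | mul a b ha hb => simp [ha, hb, mul_assoc]
  | add a b ha hb => simp [ha, hb, add_mul]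

/-- The left derivatives: the right coefficients of the `xᵢ` in `w = ε(w) + ∑ xᵢ * wᵢ`. -/
def leftDeriv (k : Type*) [Field k] :
    FreeAlgebra k (Fin 3) →ₗ[k] (Fin 3 → FreeAlgebra k (Fin 3)) :=
  LinearMap.snd k _ _ ∘ₗ LinearMap.applyₗ (1, 0) ∘ₗ (leftDerivRep k).toLinearMap

lemma leftDeriv_ι_mul (i : Fin 3) (w : 𝒜) : leftDeriv k (ι k i * w) = Pi.single i w := by
  simp [leftDeriv, leftDerivRep_ι, leftDerivRep_fst]

lemma leftDeriv_algebraMap (r : k) : leftDeriv k (algebraMap k 𝒜 r) = 0 := by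
  simp [leftDeriv, Algebra.algebraMap_eq_smul_one]

lemma eq_zero_of_ι_mul_add_eq_zero {r : k} {u v w : 𝒜}
    (h : algebraMap k 𝒜 r + x₁ * u + x₂ * v + x₃ * w = 0) :
    r = 0 ∧ u = 0 ∧ v = 0 ∧ w = 0 := by
  have hD := congrArg (leftDeriv k) h
  simp only [map_add, leftDeriv_ι_mul, leftDeriv_algebraMap, map_zero] at hD
  refine ⟨?_, by simpa using congrFun hD 0, by simpa using congrFun hD 1,
    by simpa using congrFun hD 2⟩
  have hε := congrArg (lift k (fun _ : Fin 3 => (0 : k))) h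
  simpa using hε

lemma exists_eq_algebraMap_add_ι_mul (z : 𝒜) :
    ∃ (r : k) (u v w : 𝒜), z = algebraMap k 𝒜 r + x₁ * u + x₂ * v + x₃ * w := by
  induction z using FreeAlgebra.induction with
  | grade0 r => exact ⟨r, 0, 0, 0, by simp⟩
  | grade1 i =>
    fin_cases i
    · exact ⟨0, 1, 0, 0, by simp⟩
    · exact ⟨0, 0, 1, 0, by simp⟩
    · exact ⟨0, 0, 0, 1, by simp⟩
  | mul a b ha hb =>
    obtain ⟨r, u, v, w, rfl⟩ := ha
    obtain ⟨r', u', v', w', hb⟩ := hb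
    refine ⟨r * r', r • u' + u * b, r • v' + v * b, r • w' + w * b, ?_⟩
    have hrb : algebraMap k 𝒜 r * b =
        algebraMap k 𝒜 (r * r') + x₁ * (r • u') + x₂ * (r • v') + x₃ * (r • w') := by
      conv_lhs => rw [hb]
      simp [Algebra.algebraMap_eq_smul_one, mul_smul]
    simp only [add_mul, hrb, mul_add, mul_assoc]
    abel
  | add a b ha hb =>
    obtain ⟨r, u, v, w, rfl⟩ := ha
    obtain ⟨r', u', v', w', rfl⟩ := hb
    exact ⟨r + r', u + u', v + v', w + w', by simp only [map_add, mul_add]; abel⟩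

lemma exists_eq_ι_mul_of_mem_Vgen_pow_succ {m : ℕ} {z : 𝒜} (hz : z ∈ Vgen k ^ (m + 1)) :
    ∃ u ∈ Vgen k ^ m, ∃ v ∈ Vgen k ^ m, ∃ w ∈ Vgen k ^ m, z = x₁ * u + x₂ * v + x₃ * w := by
  rw [pow_succ'] at hz
  induction hz using Submodule.mul_induction_on' with
  | mem_mul_mem g hg y hy =>
    rw [Vgen, Submodule.mem_span_triple] at hg
    obtain ⟨p, q, r, rfl⟩ := hg
    exact ⟨p • y, Submodule.smul_mem _ _ hy, q • y, Submodule.smul_mem _ _ hy,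
      r • y, Submodule.smul_mem _ _ hy, by simp [add_mul]⟩
  | add a _ b _ ha hb =>
    obtain ⟨u, hu, v, hv, w, hw, rfl⟩ := ha
    obtain ⟨u', hu', v', hv', w', hw', rfl⟩ := hb
    exact ⟨u + u', add_mem hu hu', v + v', add_mem hv hv', w + w', add_mem hw hw',
      by simp only [mul_add]; abel⟩

lemma exists_eq_algebraMap_of_mem_Vgen_pow_zero {z : 𝒜} (hz : z ∈ Vgen k ^ 0) :
    ∃ r : k, z = algebraMap k 𝒜 r := by
  obtain ⟨r, rfl⟩ := Submodule.mem_one.mp (by simpa using hz)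
  exact ⟨r, rfl⟩

lemma ι_mem_Vgen (i : Fin 3) : ι k i ∈ Vgen k := by
  apply Submodule.subset_span
  fin_cases i <;> simp

lemma x₂x₃_pow_mem (n : ℕ) : (x₂ * x₃) ^ n ∈ Vgen k ^ (2 * n) := by
  rw [pow_mul, pow_two]
  exact Submodule.pow_mem_pow _ (Submodule.mul_mem_mul (ι_mem_Vgen 1) (ι_mem_Vgen 2)) n

/-- The recursion satisfied by the differential, which determines it on words. -/
structure IsLeftRecursive (d : 𝒜 →ₗ[k] 𝒜) : Prop where
  map_one : d 1 = 0
  map_x₁_mul (w : 𝒜) : d (x₁ * w) = x₁ * (x₁ * w - d w)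
  map_x₂_mul (w : 𝒜) : d (x₂ * w) = x₂ * (x₁ * w - d w)
  map_x₃_mul (w : 𝒜) : d (x₃ * w) = x₁ * (x₃ * w) - x₃ * d w

lemma _root_.IsDGDifferential.isLeftRecursive {d : 𝒜 →ₗ[k] 𝒜} (hd : IsDGDifferential k d)
    (hx1 : d x₁ = x₁ * x₁) (hx2 : d x₂ = x₂ * x₁) (hx3 : d x₃ = x₁ * x₃) :
    IsLeftRecursive d := by
  have leibniz (i : Fin 3) (w : 𝒜) : d (ι k i * w) = d (ι k i) * w - ι k i * d w := by
    have := hd.2.1 1 (ι k i) (by simpa using ι_mem_Vgen i) w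
    simpa [sub_eq_add_neg] using this
  refine ⟨?_, fun w => ?_, fun w => ?_, fun w => ?_⟩
  · have := hd.2.1 0 1 (by simp) 1
    simpa using this
  · rw [leibniz, hx1, mul_sub, mul_assoc]
  · rw [leibniz, hx2, mul_sub, mul_assoc]
  · rw [leibniz, hx3, mul_assoc]

namespace IsLeftRecursive

variable {d : FreeAlgebra k (Fin 3) →ₗ[k] FreeAlgebra k (Fin 3)}

/-- The differential on `A` for which `w ↦ x₂ * w` intertwines it with `d`. -/
def twist (d : 𝒜 →ₗ[k] 𝒜) : 𝒜 →ₗ[k] 𝒜 := LinearMap.mulLeft k x₁ - d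

lemma twist_apply (w : 𝒜) : twist d w = x₁ * w - d w := rfl

lemma map_algebraMap (hd : IsLeftRecursive d) (r : k) : d (algebraMap k 𝒜 r) = 0 := by
  simp [Algebra.algebraMap_eq_smul_one, hd.map_one]

lemma map_combination (hd : IsLeftRecursive d) (r : k) (u v w : 𝒜) :
    d (algebraMap k 𝒜 r + x₁ * u + x₂ * v + x₃ * w) =
      x₁ * (twist d u + x₃ * w) + x₂ * twist d v - x₃ * d w := by
  simp only [map_add, hd.map_algebraMap, hd.map_x₁_mul, hd.map_x₂_mul, hd.map_x₃_mul,
    twist_apply, mul_add]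
  abel

lemma twist_combination (hd : IsLeftRecursive d) (r : k) (u v w : 𝒜) :
    twist d (algebraMap k 𝒜 r + x₁ * u + x₂ * v + x₃ * w) =
      x₁ * (algebraMap k 𝒜 r + d u + x₂ * v) - x₂ * twist d v + x₃ * d w := by
  rw [twist_apply, hd.map_combination]
  simp only [twist_apply, mul_add, mul_sub]
  abel

lemma map_combination_eq_zero (hd : IsLeftRecursive d) {u v w : 𝒜}
    (h : d (x₁ * u + x₂ * v + x₃ * w) = 0) :
    twist d u + x₃ * w = 0 ∧ twist d v = 0 ∧ d w = 0 := by
  have := hd.map_combination 0 u v w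
  rw [map_zero, zero_add, h] at this
  have := eq_zero_of_ι_mul_add_eq_zero (r := 0) (u := twist d u + x₃ * w) (v := twist d v)
    (w := -d w) (by rw [this]; simp [sub_eq_add_neg])
  simpa using this.2

lemma twist_combination_eq (hd : IsLeftRecursive d) {u v w t : 𝒜}
    (h : twist d (x₁ * u + x₂ * v + x₃ * w) = x₃ * t) :
    d u + x₂ * v = 0 ∧ twist d v = 0 ∧ d w = t := by
  have := hd.twist_combination 0 u v w
  rw [map_zero, zero_add, h] at this
  have := eq_zero_of_ι_mul_add_eq_zero (r := 0) (u := d u + x₂ * v) (v := -twist d v)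
    (w := d w - t) (by rw [mul_sub, this]; simp; abel)
  simpa [sub_eq_zero] using this.2

/-- The summands `x₁A + x₃A` of `(A, d)` and `k + x₁A + x₂A` of `(A, twist d)` are acyclic. -/
lemma acyclic_summands (hd : IsLeftRecursive d) (m : ℕ) :
    ∀ u ∈ Vgen k ^ m,
      (∀ w, d (x₁ * u + x₃ * w) = 0 → ∃ y, d y = x₁ * u + x₃ * w) ∧
      (∀ v, d u + x₂ * v = 0 → ∃ y, twist d y = x₁ * u + x₂ * v) := by
  induction m with
  | zero =>
    intro u hu
    obtain ⟨r, rfl⟩ := exists_eq_algebraMap_of_mem_Vgen_pow_zero hu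
    refine ⟨fun w h => ?_, fun v h => ?_⟩
    · have h₁ := (hd.map_combination_eq_zero (v := 0) (by simpa using h)).1
      rw [twist_apply, hd.map_algebraMap, sub_zero] at h₁
      have h₂ := eq_zero_of_ι_mul_add_eq_zero (r := (0 : k)) (u := algebraMap k 𝒜 r) (v := 0)
        (w := w) (by simpa using h₁)
      exact ⟨0, by simp [h₂.2.1, h₂.2.2.2]⟩
    · have h₂ := eq_zero_of_ι_mul_add_eq_zero (r := 0) (u := 0) (v := v) (w := 0)
        (by simpa [hd.map_algebraMap] using h)
      exact ⟨algebraMap k 𝒜 r, by simp [twist_apply, hd.map_algebraMap, h₂.2.2.1]⟩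
  | succ m ih =>
    intro u hu
    obtain ⟨u₁, hu₁, u₂, -, u₃, -, rfl⟩ := exists_eq_ι_mul_of_mem_Vgen_pow_succ hu
    refine ⟨fun w h => ?_, fun v h => ?_⟩
    · have h₁ := (hd.map_combination_eq_zero (v := 0) (by simpa using h)).1
      obtain ⟨h₂, -, h₃⟩ := hd.twist_combination_eq (u := u₁) (v := u₂) (w := u₃) (t := -w)
        (by rw [mul_neg]; exact eq_neg_of_add_eq_zero_left h₁)
      obtain ⟨y, hy⟩ := (ih u₁ hu₁).2 u₂ h₂
      refine ⟨x₁ * y + x₃ * u₃, ?_⟩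
      rw [map_add, hd.map_x₁_mul, hd.map_x₃_mul, ← twist_apply, hy, h₃]
      simp only [mul_add, mul_neg]
      abel
    · have h₁ := hd.map_combination 0 u₁ u₂ u₃
      rw [map_zero, zero_add, eq_neg_of_add_eq_zero_left h] at h₁
      have h₂ := eq_zero_of_ι_mul_add_eq_zero (r := 0) (u := twist d u₁ + x₃ * u₃)
        (v := twist d u₂ + v) (w := -d u₃) (by
          rw [map_zero, zero_add, mul_neg, mul_add x₂, ← sub_eq_add_neg, ← add_assoc,
            add_sub_right_comm, ← h₁, neg_add_cancel])
      obtain ⟨-, h₃, h₄, h₅⟩ := h₂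
      obtain ⟨y, hy⟩ := (ih u₁ hu₁).1 u₃ (by
        have := hd.map_combination 0 u₁ 0 u₃
        simpa [h₃, neg_eq_zero.mp h₅] using this)
      refine ⟨x₁ * y + x₂ * u₂, ?_⟩
      have h₆ := hd.twist_combination 0 y u₂ 0
      rw [hy, eq_neg_of_add_eq_zero_left h₄] at h₆
      simp only [map_zero, zero_add, mul_zero, add_zero, mul_neg, sub_neg_eq_add] at h₆
      rw [h₆]
      simp only [mul_add]
      abel

/-- Representatives, in degree `m`, of the cohomology of `(A, d)` and of `(A, twist d)`. -/
def cocycleRep (k : Type*) [Field k] : ℕ → FreeAlgebra k (Fin 3) × FreeAlgebra k (Fin 3)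
  | 0 => (1, 0)
  | m + 1 => (ι k 1 * (cocycleRep k m).2, ι k 2 * (cocycleRep k m).1)

lemma cocycleRep_even (n : ℕ) : cocycleRep k (2 * n) = ((x₂ * x₃) ^ n, 0) := by
  induction n with
  | zero => rfl
  | succ n ih => simp [mul_add, cocycleRep, ih, pow_succ', mul_assoc]

lemma cocycleRep_odd (n : ℕ) : (cocycleRep k (2 * n + 1)).1 = 0 := by
  simp [cocycleRep, cocycleRep_even]

lemma exists_eq_add_smul_cocycleRep (hd : IsLeftRecursive d) (m : ℕ) :
    ∀ z ∈ Vgen k ^ m,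
      (d z = 0 → ∃ y, ∃ r : k, z = d y + r • (cocycleRep k m).1) ∧
      (twist d z = 0 → ∃ y, ∃ r : k, z = twist d y + r • (cocycleRep k m).2) := by
  induction m with
  | zero =>
    intro z hz
    obtain ⟨r, rfl⟩ := exists_eq_algebraMap_of_mem_Vgen_pow_zero hz
    refine ⟨fun _ => ⟨0, r, by simp [cocycleRep, Algebra.algebraMap_eq_smul_one]⟩, fun h => ?_⟩
    rw [twist_apply, hd.map_algebraMap, sub_zero] at h
    have h₁ := eq_zero_of_ι_mul_add_eq_zero (r := (0 : k)) (u := algebraMap k 𝒜 r) (v := 0) (w := 0)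
      (by rw [h]; simp)
    exact ⟨0, 0, by simp [h₁.2.1]⟩
  | succ m ih =>
    intro z hz
    obtain ⟨u, hu, v, hv, w, hw, rfl⟩ := exists_eq_ι_mul_of_mem_Vgen_pow_succ hz
    refine ⟨fun h => ?_, fun h => ?_⟩
    · obtain ⟨h₁, h₂, h₃⟩ := hd.map_combination_eq_zero h
      obtain ⟨y, hy⟩ := (hd.acyclic_summands m u hu).1 w (by
        have := hd.map_combination 0 u 0 w
        simpa [h₁, h₃] using this)
      obtain ⟨y', r, rfl⟩ := (ih v hv).2 h₂
      refine ⟨y + x₂ * y', r, ?_⟩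
      rw [map_add, hy, hd.map_x₂_mul, ← twist_apply]
      simp only [cocycleRep, mul_add, mul_smul_comm]
      abel
    · obtain ⟨h₁, -, h₃⟩ := hd.twist_combination_eq (t := 0) (by rw [h, mul_zero])
      obtain ⟨y, hy⟩ := (hd.acyclic_summands m u hu).2 v h₁
      obtain ⟨y', r, rfl⟩ := (ih w hw).1 h₃
      refine ⟨y + x₃ * y', r, ?_⟩
      have h₄ := hd.twist_combination 0 0 0 y'
      simp only [map_zero, zero_add, mul_zero, add_zero, sub_zero] at h₄
      rw [map_add, hy, h₄]
      simp only [cocycleRep, mul_add, mul_smul_comm]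
      abel

lemma map_ne_one (hd : IsLeftRecursive d) (y : 𝒜) : d y ≠ 1 := by
  intro h
  obtain ⟨r, u, v, w, rfl⟩ := exists_eq_algebraMap_add_ι_mul y
  rw [hd.map_combination] at h
  simpa using congrArg (lift k (fun _ : Fin 3 => (0 : k))) h

lemma map_x₂x₃_mul (hd : IsLeftRecursive d) (w : 𝒜) : d (x₂ * x₃ * w) = x₂ * x₃ * d w := by
  rw [mul_assoc, hd.map_x₂_mul, hd.map_x₃_mul, sub_sub_cancel, mul_assoc]

lemma map_x₂x₃_pow (hd : IsLeftRecursive d) (n : ℕ) : d ((x₂ * x₃) ^ n) = 0 := by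
  induction n with
  | zero => simpa using hd.map_one
  | succ n ih => rw [pow_succ', hd.map_x₂x₃_mul, ih, mul_zero]

lemma exists_map_eq_of_map_eq_x₂x₃_mul (hd : IsLeftRecursive d) {y z : 𝒜}
    (h : d y = x₂ * x₃ * z) : ∃ w, d w = z := by
  obtain ⟨r, u, v, w, rfl⟩ := exists_eq_algebraMap_add_ι_mul y
  rw [hd.map_combination] at h
  have h₁ := eq_zero_of_ι_mul_add_eq_zero (r := 0) (u := twist d u + x₃ * w)
    (v := twist d v - x₃ * z) (w := -d w) (by
      rw [mul_sub, ← mul_assoc, ← h, map_zero, mul_neg]; abel)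
  obtain ⟨r', u', v', w', rfl⟩ := exists_eq_algebraMap_add_ι_mul v
  rw [hd.twist_combination] at h₁
  have h₂ := eq_zero_of_ι_mul_add_eq_zero (r := 0) (u := algebraMap k 𝒜 r' + d u' + x₂ * v')
    (v := -twist d v') (w := d w' - z) (by
      rw [← h₁.2.2.1, mul_sub, map_zero, mul_neg]; abel)
  exact ⟨w', sub_eq_zero.mp h₂.2.2.2⟩

lemma x₂x₃_pow_notMem_range (hd : IsLeftRecursive d) (n : ℕ) :
    (x₂ * x₃) ^ n ∉ LinearMap.range d := by
  induction n with
  | zero =>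
    rintro ⟨y, hy⟩
    exact hd.map_ne_one y (by simpa using hy)
  | succ n ih =>
    rintro ⟨y, hy⟩
    exact ih (hd.exists_map_eq_of_map_eq_x₂x₃_mul (by rw [hy, pow_succ']))

end IsLeftRecursive

end FreeAlgebra

/-- Suppose `d` is a differential on `A` with `d x1 = x1*x1`, `d x2 = x2*x1`
and `d x3 = x1*x3`. Then: (i) for every `n ≥ 1`, `ker d ∩ A_{2n−1} ⊆ range d`; (ii) for every
`n ≥ 0`, `ker d ∩ A_{2n} = (range d ∩ A_{2n}) + k·(x2*x3)^n`; and (iii) for every `n ≥ 1`,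
`(x2*x3)^n ∉ range d`.  (Equivalently, `H(A, d) = k[⌈x2x3⌉]`.) -/
theorem cohomology_of_dgfree_polynomial (k : Type*) [Field k] [CharZero k]
    (d : FreeAlgebra k (Fin 3) →ₗ[k] FreeAlgebra k (Fin 3))
    (hd : IsDGDifferential k d)
    (hx1 : d (FreeAlgebra.ι k 0) = FreeAlgebra.ι k 0 * FreeAlgebra.ι k 0)
    (hx2 : d (FreeAlgebra.ι k 1) = FreeAlgebra.ι k 1 * FreeAlgebra.ι k 0)
    (hx3 : d (FreeAlgebra.ι k 2) = FreeAlgebra.ι k 0 * FreeAlgebra.ι k 2) :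
    (∀ n : ℕ, 1 ≤ n →
      ∀ a ∈ LinearMap.ker d ⊓ (Vgen k) ^ (2 * n - 1), a ∈ LinearMap.range d) ∧
    (∀ n : ℕ,
      LinearMap.ker d ⊓ (Vgen k) ^ (2 * n) =
        (LinearMap.range d ⊓ (Vgen k) ^ (2 * n)) ⊔
          Submodule.span k {(FreeAlgebra.ι k 1 * FreeAlgebra.ι k 2) ^ n}) ∧
    (∀ n : ℕ, 1 ≤ n →
      (FreeAlgebra.ι k 1 * FreeAlgebra.ι k 2) ^ n ∉ LinearMap.range d) := by
  have hrec := hd.isLeftRecursive hx1 hx2 hx3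
  refine ⟨fun n hn a ha => ?_, fun n => le_antisymm ?_ ?_, fun n _ => hrec.x₂x₃_pow_notMem_range n⟩
  · obtain ⟨m, rfl⟩ := Nat.exists_eq_add_of_le' hn
    obtain ⟨hker, hdeg⟩ := ha
    rw [show 2 * (m + 1) - 1 = 2 * m + 1 by omega] at hdeg
    obtain ⟨y, r, rfl⟩ := (hrec.exists_eq_add_smul_cocycleRep _ a hdeg).1 hker
    exact ⟨y, by simp [FreeAlgebra.IsLeftRecursive.cocycleRep_odd]⟩
  · rintro a ⟨hker, hdeg⟩
    obtain ⟨y, r, hy⟩ := (hrec.exists_eq_add_smul_cocycleRep _ a hdeg).1 hker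
    rw [FreeAlgebra.IsLeftRecursive.cocycleRep_even] at hy
    refine Submodule.mem_sup.mpr ⟨d y, ⟨⟨y, rfl⟩, ?_⟩, _,
      Submodule.smul_mem _ r (Submodule.mem_span_singleton_self _), hy.symm⟩
    rw [eq_sub_of_add_eq hy.symm]
    exact sub_mem hdeg (Submodule.smul_mem _ r (FreeAlgebra.x₂x₃_pow_mem n))
  · refine sup_le (inf_le_inf_right _ ?_) ?_
    · rintro _ ⟨y, rfl⟩
      exact hd.2.2 y
    · rw [Submodule.span_singleton_le_iff_mem]
      exact ⟨hrec.map_x₂x₃_pow n, FreeAlgebra.x₂x₃_pow_mem n⟩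
end
end
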